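/- arXiv:2412.08887 — 5 statements merged into one kernel-verified Lean document; each statement's English description precedes it below -/
import Mathlib

section
/- Let k be a commutative ring, p a prime number, and A a commutative k-algebra in which p = 0 (so A has characteristic p). Then for all a, b ∈ A there exists c ∈ A such that in the module of Kähler differentials Ω_{A/k} one has (a+b)^{p-1}·d(a+b) − a^{p-1}·da − b^{p-1}·db = dc, where d : A → Ω_{A/k} is the universal derivation. In other words, the map γ(a) := a^{p-1}·da is additive modulo exact differential forms. -/
open MvPolynomial in
/-- The chain rule for a derivation evaluated on a polynomial in two elements. -/
theorem Derivation.map_mvPolynomial_aeval_pair {R A M : Type*} [CommRing R] [CommRing A]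
    [Algebra R A] [AddCommGroup M] [Module A M] [Module R M]
    (D : Derivation R A M) (a b : A) (P : MvPolynomial (Fin 2) R) :
    D (aeval ![a, b] P) =
      aeval ![a, b] (pderiv 0 P) • D a + aeval ![a, b] (pderiv 1 P) • D b := by
  induction P using MvPolynomial.induction_on with
  | C r => simp
  | add P Q hP hQ =>
    simp only [map_add, hP, hQ, add_smul]
    abel
  | mul_X P i hP =>
    simp only [map_mul, Derivation.leibniz, hP, aeval_X, pderiv_X, smul_eq_mul, map_add]
    fin_cases i <;> simp <;> module

open MvPolynomial in
/-- The polynomial `((X + Y) ^ p - X ^ p - Y ^ p) / p` is integral, and its partial derivatives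
are `(X + Y) ^ (p - 1) - X ^ (p - 1)` and `(X + Y) ^ (p - 1) - Y ^ (p - 1)`. -/
theorem MvPolynomial.exists_pderiv_eq_add_pow_sub_pow {p : ℕ} (hp : p.Prime) :
    ∃ P : MvPolynomial (Fin 2) ℤ,
      pderiv 0 P = (X 0 + X 1) ^ (p - 1) - X 0 ^ (p - 1) ∧
      pderiv 1 P = (X 0 + X 1) ^ (p - 1) - X 1 ^ (p - 1) := by
  obtain ⟨r, hr⟩ := exists_add_pow_prime_eq hp (X 0 : MvPolynomial (Fin 2) ℤ) (X 1)
  have hp0 : (p : MvPolynomial (Fin 2) ℤ) ≠ 0 := Nat.cast_ne_zero.mpr hp.ne_zero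
  have key (i : Fin 2) := congrArg (pderiv i) (show (X 0 + X 1) ^ p =
    X 0 ^ p + X 1 ^ p + (p : MvPolynomial (Fin 2) ℤ) * (X 0 * X 1 * r) by rw [hr]; ring)
  refine ⟨X 0 * X 1 * r, mul_left_cancel₀ hp0 ?_, mul_left_cancel₀ hp0 ?_⟩
  · have h := key 0
    rw [map_add, map_add, Derivation.leibniz _ (p : MvPolynomial (Fin 2) ℤ)] at h
    simp only [Derivation.leibniz_pow, map_add, pderiv_X_self, Derivation.map_natCast,
      pderiv_X_of_ne (show (1 : Fin 2) ≠ 0 by decide), smul_eq_mul, nsmul_eq_mul] at h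
    linear_combination -h
  · have h := key 1
    rw [map_add, map_add, Derivation.leibniz _ (p : MvPolynomial (Fin 2) ℤ)] at h
    simp only [Derivation.leibniz_pow, map_add, pderiv_X_self, Derivation.map_natCast,
      pderiv_X_of_ne (show (0 : Fin 2) ≠ 1 by decide), smul_eq_mul, nsmul_eq_mul] at h
    linear_combination -h


/-- The map `γ(a) := a^(p-1) · da` on a commutative algebra `A` of prime characteristic `p`
over a commutative ring `k` is additive modulo exact Kähler differential forms:
for all `a b : A` there is `c : A` with
`(a+b)^(p-1)·d(a+b) − a^(p-1)·da − b^(p-1)·db = dc` in `Ω[A⁄k]`. -/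
theorem stmt2 (k : Type*) [CommRing k] (A : Type*) [CommRing A] [Algebra k A]
    (p : ℕ) (hp : p.Prime) (hpA : (p : A) = 0) (a b : A) :
    ∃ c : A,
      (a + b) ^ (p - 1) • (KaehlerDifferential.D k A) (a + b)
          - a ^ (p - 1) • (KaehlerDifferential.D k A) a
          - b ^ (p - 1) • (KaehlerDifferential.D k A) b
        = (KaehlerDifferential.D k A) c := by
  obtain ⟨P, h₀, h₁⟩ := MvPolynomial.exists_pderiv_eq_add_pow_sub_pow hp
  refine ⟨MvPolynomial.aeval ![a, b] P, ?_⟩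
  have h := ((KaehlerDifferential.D k A).restrictScalars ℤ).map_mvPolynomial_aeval_pair a b P
  rw [Derivation.restrictScalars_apply] at h
  rw [h, h₀, h₁]
  simp
  module
end

section
/- Let k be a commutative ring, p a prime number, and A a commutative k-algebra in which p = 0. Let B ⊆ Ω_{A/k} be the additive subgroup consisting of all exact forms dc for c ∈ A (the image of the universal derivation d, which is an additive subgroup). Then there exists a unique additive group homomorphism γ̄ : Ω_{A/k} → Ω_{A/k}/B such that for all a, b ∈ A, γ̄(a·db) equals the class of a^p·b^{p-1}·db modulo B. -/
/-- The subgroup of exact forms: the additive subgroup `BΩ¹ ⊆ Ω[A⁄k]` consisting of all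
differentials `dc` for `c : A`, i.e. the range of the universal derivation `d` viewed as
an additive map. -/
noncomputable def exactForms (k : Type*) [CommRing k] (A : Type*) [CommRing A]
    [Algebra k A] : AddSubgroup (Ω[A⁄k]) :=
  ((KaehlerDifferential.D k A).toLinearMap.toAddMonoidHom).range

open KaehlerDifferential in
/-- The map `b ↦ b ^ n • db` is additive modulo exact forms whenever `n + 1` is prime. -/
theorem pow_smul_D_add_sub_mem_exactForms (k : Type*) [CommRing k] (A : Type*) [CommRing A]
    [Algebra k A] {n : ℕ} (hn : (n + 1).Prime) (a b : A) :
    (a + b) ^ n • D k A (a + b) - a ^ n • D k A a - b ^ n • D k A b ∈ exactForms k A := by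
  have hdvd : ∀ i, ∃ m : ℕ, i < n → (n + 1).choose (i + 1) = (n + 1) * m := fun i ↦ by
    by_cases h : i < n
    · obtain ⟨m, hm⟩ := hn.dvd_choose_self (k := i + 1) (by omega) (by omega)
      exact ⟨m, fun _ ↦ hm⟩
    · exact ⟨0, fun h' ↦ absurd h' h⟩
  choose m hm using hdvd
  have hleft : ∀ i < n, m i * (i + 1) = n.choose i := fun i hi ↦ by
    apply Nat.eq_of_mul_eq_mul_left n.succ_pos
    rw [Nat.succ_eq_add_one, Nat.add_one_mul_choose_eq, hm i hi, mul_assoc]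
  have hright : ∀ i < n, m i * (n - 1 - i + 1) = n.choose (i + 1) := fun i hi ↦ by
    apply Nat.eq_of_mul_eq_mul_left n.succ_pos
    rw [Nat.succ_eq_add_one, mul_comm _ (n.choose _), Nat.choose_mul_succ_eq, hm i hi, mul_assoc]
    congr 3
    omega
  have hsum_left : ∑ i ∈ Finset.range n, a ^ i * b ^ (n - i) * (n.choose i : A)
      = (a + b) ^ n - a ^ n := by
    rw [add_pow, Finset.sum_range_succ]
    simp
  have hsum_right : ∑ i ∈ Finset.range n, a ^ (i + 1) * b ^ (n - (i + 1)) * (n.choose (i + 1) : A)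
      = (a + b) ^ n - b ^ n := by
    rw [add_pow, Finset.sum_range_succ']
    simp
  refine ⟨∑ i ∈ Finset.range n, (m i : A) * (a ^ (i + 1) * b ^ (n - 1 - i + 1)), ?_⟩
  change D k A _ = _
  have hterm : ∀ i ∈ Finset.range n, D k A ((m i : A) * (a ^ (i + 1) * b ^ (n - 1 - i + 1)))
      = (a ^ i * b ^ (n - i) * (n.choose i : A)) • D k A a
        + (a ^ (i + 1) * b ^ (n - (i + 1)) * (n.choose (i + 1) : A)) • D k A b := by
    intro i hi
    have hi := Finset.mem_range.mp hi
    rw [← hleft i hi, ← hright i hi, show n - i = n - 1 - i + 1 by omega,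
      show n - (i + 1) = n - 1 - i by omega]
    simp only [Derivation.leibniz, Derivation.leibniz_pow, Derivation.map_natCast,
      add_tsub_cancel_right, ← Nat.cast_smul_eq_nsmul A]
    push_cast
    module
  rw [map_sum, Finset.sum_congr rfl hterm, Finset.sum_add_distrib, ← Finset.sum_smul,
    ← Finset.sum_smul, hsum_left, hsum_right, map_add]
  module

/-- Multiplication by a `p`-th power preserves exact forms when `p = 0`. -/
theorem pow_smul_mem_exactForms (k : Type*) [CommRing k] {A : Type*} [CommRing A]
    [Algebra k A] {p : ℕ} (hpA : (p : A) = 0) (a : A) {ω : Ω[A⁄k]} (hω : ω ∈ exactForms k A) :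
    a ^ p • ω ∈ exactForms k A := by
  obtain ⟨c, rfl⟩ := hω
  refine ⟨a ^ p * c, ?_⟩
  change KaehlerDifferential.D k A _ = a ^ p • KaehlerDifferential.D k A c
  rw [Derivation.leibniz, Derivation.leibniz_pow, ← Nat.cast_smul_eq_nsmul A, hpA]
  simp

/-- The action of `A` on `Ω[A⁄k]` modulo exact forms through `p`-th powers. -/
noncomputable def powActionModExact (k : Type*) [CommRing k] {A : Type*} [CommRing A]
    [Algebra k A] {p : ℕ} (hp : p.Prime) (hpA : (p : A) = 0) :
    A →+* AddMonoid.End (Ω[A⁄k] ⧸ exactForms k A) where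
  toFun a := QuotientAddGroup.map _ _ (DistribSMul.toAddMonoidHom (Ω[A⁄k]) (a ^ p))
    fun _ ↦ pow_smul_mem_exactForms k hpA a
  map_one' := by
    ext ⟨ω⟩
    exact congrArg QuotientAddGroup.mk (show (1 : A) ^ p • ω = ω by simp)
  map_zero' := by
    ext ⟨ω⟩
    exact congrArg QuotientAddGroup.mk (show (0 : A) ^ p • ω = 0 by simp [hp.ne_zero])
  map_mul' a b := by
    ext ⟨ω⟩
    exact congrArg QuotientAddGroup.mk
      (show (a * b) ^ p • ω = a ^ p • b ^ p • ω by rw [mul_pow, mul_smul])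
  map_add' a b := by
    obtain ⟨r, hr⟩ := exists_add_pow_prime_eq hp a b
    ext ⟨ω⟩
    exact congrArg QuotientAddGroup.mk
      (show (a + b) ^ p • ω = a ^ p • ω + b ^ p • ω by simp [hr, hpA, add_smul])

open KaehlerDifferential in
/-- **Well-definedness (and uniqueness) of the inverse Cartier map in degree one.**
Let `k` be a commutative ring, `p` a prime, and `A` a commutative `k`-algebra with `p = 0`
in `A`.  Let `B ⊆ Ω[A⁄k]` be the additive subgroup of exact forms `dc`, `c : A`.  Then there
is a unique additive group homomorphism `γ̄ : Ω[A⁄k] →+ Ω[A⁄k]/B` such that for all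
`a b : A`, `γ̄(a·db)` is the class of `a^p·b^(p-1)·db` modulo `B`. -/
theorem stmt3 (k : Type*) [CommRing k] (A : Type*) [CommRing A] [Algebra k A]
    (p : ℕ) (hp : p.Prime) (hpA : (p : A) = 0) :
    ∃! γ : Ω[A⁄k] →+ (Ω[A⁄k] ⧸ exactForms k A),
      ∀ a b : A,
        γ (a • (KaehlerDifferential.D k A) b)
          = QuotientAddGroup.mk ((a ^ p * b ^ (p - 1)) • (KaehlerDifferential.D k A) b) := by
  obtain ⟨n, rfl⟩ : ∃ n, p = n + 1 := ⟨p - 1, by have := hp.pos; omega⟩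
  simp only [add_tsub_cancel_right]
  refine existsUnique_of_exists_of_unique ?_ ?_
  · let _ : Module A (Ω[A⁄k] ⧸ exactForms k A) := Module.compHom _ (powActionModExact k hp hpA)
    let _ : Module k (Ω[A⁄k] ⧸ exactForms k A) := Module.compHom _ (algebraMap k A)
    have : IsScalarTower k A (Ω[A⁄k] ⧸ exactForms k A) := .of_algebraMap_smul fun _ _ ↦ rfl
    have smul_mk (a : A) (ω : Ω[A⁄k]) : a • (QuotientAddGroup.mk ω : Ω[A⁄k] ⧸ exactForms k A)
        = QuotientAddGroup.mk (a ^ (n + 1) • ω) := rfl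
    let δ : Derivation k A (Ω[A⁄k] ⧸ exactForms k A) := Derivation.mk'
      { toFun b := QuotientAddGroup.mk (b ^ n • D k A b)
        map_add' a b := by
          rw [← QuotientAddGroup.mk_add, eq_comm, QuotientAddGroup.eq]
          convert pow_smul_D_add_sub_mem_exactForms k A hp a b using 1
          abel
        map_smul' c b := by
          rw [RingHom.id_apply, ← algebraMap_smul A c (QuotientAddGroup.mk _), smul_mk]
          congr 1
          rw [Algebra.smul_def, Derivation.leibniz, Derivation.map_algebraMap]
          module }
      fun a b ↦ by
        change QuotientAddGroup.mk _ = a • QuotientAddGroup.mk _ + b • QuotientAddGroup.mk _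
        rw [smul_mk, smul_mk, ← QuotientAddGroup.mk_add]
        congr 1
        rw [Derivation.leibniz]
        module
    refine ⟨δ.liftKaehlerDifferential.toAddMonoidHom, fun a b ↦ ?_⟩
    change δ.liftKaehlerDifferential (a • D k A b) = _
    rw [map_smul, Derivation.liftKaehlerDifferential_comp_D, mul_smul]
    rfl
  · intro γ₁ γ₂ h₁ h₂
    have key (ω : Ω[A⁄k]) : ∀ a : A, γ₁ (a • ω) = γ₂ (a • ω) := by
      have hω : ω ∈ Submodule.span A (Set.range (D k A)) := by
        rw [span_range_derivation]
        trivial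
      induction hω using Submodule.span_induction with
      | mem _ h =>
        obtain ⟨b, rfl⟩ := h
        exact fun a ↦ (h₁ a b).trans (h₂ a b).symm
      | zero => simp
      | add x y _ _ hx hy => simp [hx, hy]
      | smul c x _ hx => simpa only [smul_smul] using fun a ↦ hx (a * c)
    ext ω
    simpa using key ω 1
end

section
/- Let k be a field, n ≥ 1, A = k[x₁,…,xₙ], and set R = A/(x₁x₂⋯xₙ), R₁ = A/(x₁), R₂ = A/(x₂⋯xₙ), R₁₂ = A/(x₁, x₂⋯xₙ). Then for every i ≥ 1 the sequence of A-modules 0 → Ω^i_R/tors → (Ω^i_{R₂}/tors) ⊕ Ω^i_{R₁} → Ω^i_{R₁₂}/tors → 0 is exact, where the first map is the pair of canonical restriction maps (induced by the ring quotient maps R → R₂ and R → R₁) and the second map sends a pair (ω, η) to the difference of their canonical restrictions to Ω^i_{R₁₂}/tors. -/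
set_option maxHeartbeats 1000000
set_option synthInstance.maxHeartbeats 400000

open ExteriorAlgebra MvPolynomial

noncomputable section

/-- `Ω^i_S`: the `i`-th exterior power (over `S`) of the module of Kähler differentials
of a `k`-algebra `S`. -/
abbrev OmegaPow (k : Type*) [CommRing k] (S : Type*) [CommRing S] [Algebra k S] (i : ℕ) :=
  ↥(⋀[S]^i (Ω[S⁄k]))

/-- The generator `s₀ • (d s₁ ∧ ⋯ ∧ d sᵢ)` of `Ω^i_S`. -/
def omegaGen (k : Type*) [CommRing k] (S : Type*) [CommRing S] [Algebra k S] (i : ℕ)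
    (s₀ : S) (v : Fin i → S) : OmegaPow k S i :=
  s₀ • ⟨ExteriorAlgebra.ιMulti S i (fun t => KaehlerDifferential.D k S (v t)),
    ExteriorAlgebra.ιMulti_range S i (Set.mem_range_self _)⟩

/-- `Ω^i_S / torsion`: the quotient of `Ω^i_S` by its torsion submodule (elements annihilated
by some nonzerodivisor). -/
abbrev OmegaPowModTors (k : Type*) [CommRing k] (S : Type*) [CommRing S] [Algebra k S]
    (i : ℕ) :=
  OmegaPow k S i ⧸ Submodule.torsion S (OmegaPow k S i)

/-- The class of the generator `s₀ • (d s₁ ∧ ⋯ ∧ d sᵢ)` in `Ω^i_S / torsion`. -/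
def omegaGenTors (k : Type*) [CommRing k] (S : Type*) [CommRing S] [Algebra k S] (i : ℕ)
    (s₀ : S) (v : Fin i → S) : OmegaPowModTors k S i :=
  Submodule.Quotient.mk (omegaGen k S i s₀ v)

/-- The polynomial ring `A = k[x₁, …, x_{n+1}]`. -/
abbrev polyA (k : Type*) [Field k] (n : ℕ) := MvPolynomial (Fin (n + 1)) k

/-- The ideal `(x₁ ⋯ x_{n+1})` of `A`. -/
abbrev idealR (k : Type*) [Field k] (n : ℕ) : Ideal (polyA k n) :=
  Ideal.span {∏ j, X j}

/-- The ideal `(x₁)` of `A`. -/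
abbrev idealR1 (k : Type*) [Field k] (n : ℕ) : Ideal (polyA k n) :=
  Ideal.span {X 0}

/-- The ideal `(x₂ ⋯ x_{n+1})` of `A`. -/
abbrev idealR2 (k : Type*) [Field k] (n : ℕ) : Ideal (polyA k n) :=
  Ideal.span {∏ j ∈ Finset.univ.erase 0, X j}

/-- The ideal `(x₁, x₂ ⋯ x_{n+1})` of `A`. -/
abbrev idealR12 (k : Type*) [Field k] (n : ℕ) : Ideal (polyA k n) :=
  Ideal.span {X 0, ∏ j ∈ Finset.univ.erase 0, X j}

/-- `R = A/(x₁ ⋯ x_{n+1})`, the coordinate ring of the simple normal crossing divisor `E`. -/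
abbrev ringR (k : Type*) [Field k] (n : ℕ) := polyA k n ⧸ idealR k n

/-- `R₁ = A/(x₁)`, the coordinate ring of the component `E₁`. -/
abbrev ringR1 (k : Type*) [Field k] (n : ℕ) := polyA k n ⧸ idealR1 k n

/-- `R₂ = A/(x₂ ⋯ x_{n+1})`, the coordinate ring of the union `E₁ᶜ` of the other
components. -/
abbrev ringR2 (k : Type*) [Field k] (n : ℕ) := polyA k n ⧸ idealR2 k n

/-- `R₁₂ = A/(x₁, x₂ ⋯ x_{n+1})`, the coordinate ring of the intersection `E₁ ∩ E₁ᶜ`. -/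
abbrev ringR12 (k : Type*) [Field k] (n : ℕ) := polyA k n ⧸ idealR12 k n

end

section DifferentialForms

variable {k : Type*} [CommRing k] {S T : Type*} [CommRing S] [Algebra k S] [CommRing T]
  [Algebra k T] {i : ℕ}

theorem omegaGen_eq_smul_ιMulti (s : S) (v : Fin i → S) :
    omegaGen k S i s v =
      s • exteriorPower.ιMulti S i (fun t => KaehlerDifferential.D k S (v t)) :=
  rfl

/-- Differential forms are sums of generators `s₀ • (d s₁ ∧ ⋯ ∧ d sᵢ)`. -/
theorem omegaPow_induction {p : OmegaPow k S i → Prop} (zero : p 0)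
    (add : ∀ x y, p x → p y → p (x + y)) (gen : ∀ s v, p (omegaGen k S i s v))
    (ω : OmegaPow k S i) : p ω := by
  have hω : ω ∈ (⊤ : Submodule S (OmegaPow k S i)) := trivial
  rw [← exteriorPower.ιMulti_span_of_span S i _ (KaehlerDifferential.span_range_derivation k S)] at hω
  induction hω using Submodule.closure_induction with
  | zero => exact zero
  | add x y _ _ hx hy => exact add x y hx hy
  | smul_mem s x hx =>
    obtain ⟨w, hw, rfl⟩ := hx
    choose v hv using fun t => hw (Set.mem_range_self t)
    obtain rfl : w = fun t => KaehlerDifferential.D k S (v t) := funext fun t => (hv t).symm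
    exact gen s v

/-- The alternating map `(ω₁, …, ωᵢ) ↦ f^* ω₁ ∧ ⋯ ∧ f^* ωᵢ` for the structure map `f : S → T`. -/
noncomputable def omegaMapAlternating (k S T : Type*) [CommRing k] [CommRing S] [Algebra k S]
    [CommRing T] [Algebra k T] [Algebra S T] [IsScalarTower k S T] (i : ℕ) :
    Ω[S⁄k] [⋀^Fin i]→ₗ[S] OmegaPow k T i where
  toMultilinearMap := ((exteriorPower.ιMulti T i).toMultilinearMap.restrictScalars S).compLinearMap
    fun _ => KaehlerDifferential.map k k S T
  map_eq_zero_of_eq' v _ _ h hst :=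
    (exteriorPower.ιMulti T i).map_eq_zero_of_eq
      (fun r => KaehlerDifferential.map k k S T (v r))
      (congrArg (KaehlerDifferential.map k k S T) h) hst

/-- The pullback of differential forms along a homomorphism of `k`-algebras. -/
noncomputable def omegaMap (i : ℕ) (f : S →ₐ[k] T) : OmegaPow k S i →+ OmegaPow k T i :=
  letI := f.toRingHom.toAlgebra
  haveI : IsScalarTower k S T := .of_algebraMap_eq fun x => (f.commutes x).symm
  (exteriorPower.alternatingMapLinearEquiv (omegaMapAlternating k S T i)).toAddMonoidHom

theorem omegaMap_smul (f : S →ₐ[k] T) (s : S) (ω : OmegaPow k S i) :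
    omegaMap i f (s • ω) = f s • omegaMap i f ω := by
  let _ := f.toRingHom.toAlgebra
  have _ : IsScalarTower k S T := .of_algebraMap_eq fun x => (f.commutes x).symm
  exact (map_smul (exteriorPower.alternatingMapLinearEquiv (omegaMapAlternating k S T i)) s ω).trans
    (algebraMap_smul T s _).symm

theorem omegaMap_omegaGen (f : S →ₐ[k] T) (s : S) (v : Fin i → S) :
    omegaMap i f (omegaGen k S i s v) = omegaGen k T i (f s) (fun t => f (v t)) := by
  let _ := f.toRingHom.toAlgebra
  have _ : IsScalarTower k S T := .of_algebraMap_eq fun x => (f.commutes x).symm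
  rw [omegaGen_eq_smul_ιMulti, omegaMap_smul, omegaGen_eq_smul_ιMulti]
  congr 1
  refine (exteriorPower.alternatingMapLinearEquiv_apply_ιMulti
    (omegaMapAlternating k S T i) _).trans ?_
  exact congrArg (exteriorPower.ιMulti T i)
    (funext fun t => KaehlerDifferential.map_D k k S T (v t))

theorem omegaMap_surjective {f : S →ₐ[k] T} (hf : Function.Surjective f) :
    Function.Surjective (omegaMap i f) := by
  intro ω
  induction ω using omegaPow_induction with
  | zero => exact ⟨0, map_zero _⟩
  | add x y hx hy =>
    obtain ⟨x, rfl⟩ := hx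
    obtain ⟨y, rfl⟩ := hy
    exact ⟨x + y, map_add _ _ _⟩
  | gen s v =>
    obtain ⟨s, rfl⟩ := hf s
    choose w hw using fun t => hf (v t)
    exact ⟨omegaGen k S i s w, by simp only [omegaMap_omegaGen, hw]⟩

theorem omegaMap_comp {U : Type*} [CommRing U] [Algebra k U] (g : T →ₐ[k] U) (f : S →ₐ[k] T)
    (ω : OmegaPow k S i) : omegaMap i g (omegaMap i f ω) = omegaMap i (g.comp f) ω := by
  induction ω using omegaPow_induction with
  | zero => simp only [map_zero]
  | add x y hx hy => simp only [map_add, hx, hy]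
  | gen s v => simp only [omegaMap_omegaGen, AlgHom.comp_apply]

theorem omegaGen_eq_zero_of_eq_zero (s : S) {v : Fin i → S} {t : Fin i} (h : v t = 0) :
    omegaGen k S i s v = 0 := by
  rw [omegaGen_eq_smul_ιMulti, AlternatingMap.map_coord_zero _ t (by rw [h, map_zero]), smul_zero]

/-- The restriction of forms modulo torsion in the target. -/
noncomputable def omegaMapModTors (i : ℕ) (f : S →ₐ[k] T) :
    OmegaPow k S i →+ OmegaPowModTors k T i :=
  (Submodule.torsion T (OmegaPow k T i)).mkQ.toAddMonoidHom.comp (omegaMap i f)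

theorem omegaMapModTors_eq_zero_iff {f : S →ₐ[k] T} {ω : OmegaPow k S i} :
    omegaMapModTors i f ω = 0 ↔ omegaMap i f ω ∈ Submodule.torsion T (OmegaPow k T i) :=
  Submodule.Quotient.mk_eq_zero _

theorem omegaMapModTors_surjective {f : S →ₐ[k] T} (hf : Function.Surjective f) :
    Function.Surjective (omegaMapModTors i f) :=
  (Submodule.mkQ_surjective _).comp (omegaMap_surjective hf)

theorem omegaMapModTors_omegaGen (f : S →ₐ[k] T) (s : S) (v : Fin i → S) :
    omegaMapModTors i f (omegaGen k S i s v) = omegaGenTors k T i (f s) fun t => f (v t) :=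
  congrArg Submodule.Quotient.mk (omegaMap_omegaGen f s v)

end DifferentialForms

section NormalCrossings

variable {k : Type*} [Field k] {σ : Type*}

theorem prod_X_ne_zero (T : Finset σ) : (∏ l ∈ T, X l : MvPolynomial σ k) ≠ 0 :=
  Finset.prod_ne_zero_iff.mpr fun l _ => X_ne_zero l

/-- The ideal of the normal crossing divisor `∏ l ∈ T, X l = 0` in the coordinate subspace
`X z = 0`, `z ∈ Z`. -/
noncomputable def sncIdeal (k : Type*) [Field k] {σ : Type*} (Z T : Finset σ) :
    Ideal (MvPolynomial σ k) :=
  Ideal.span (X '' (Z : Set σ)) ⊔ Ideal.span {∏ l ∈ T, X l}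

theorem X_mem_sncIdeal {Z : Finset σ} (T : Finset σ) {z : σ} (hz : z ∈ Z) :
    (X z : MvPolynomial σ k) ∈ sncIdeal k Z T :=
  Ideal.mem_sup_left (Ideal.subset_span ⟨z, hz, rfl⟩)

theorem prod_X_mem_sncIdeal (Z T : Finset σ) :
    (∏ l ∈ T, X l : MvPolynomial σ k) ∈ sncIdeal k Z T :=
  Ideal.mem_sup_right (Ideal.mem_span_singleton_self _)

theorem mem_sncIdeal_iff {Z T : Finset σ} {a : MvPolynomial σ k} :
    a ∈ sncIdeal k Z T ↔ ∃ b, a - b * ∏ l ∈ T, X l ∈ Ideal.span (X '' (Z : Set σ)) := by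
  constructor
  · intro h
    obtain ⟨q, hq, r, hr, rfl⟩ := Submodule.mem_sup.mp h
    obtain ⟨b, rfl⟩ := Ideal.mem_span_singleton'.mp hr
    exact ⟨b, by simpa using hq⟩
  · rintro ⟨b, hb⟩
    rw [← sub_add_cancel a (b * ∏ l ∈ T, X l)]
    exact add_mem (Ideal.mem_sup_left hb) (Ideal.mul_mem_left _ _ (prod_X_mem_sncIdeal Z T))

variable [DecidableEq σ]

/-- The substitution `X l ↦ 0` for `l ∈ U`. -/
noncomputable def killVars (k : Type*) [Field k] {σ : Type*} [DecidableEq σ] (U : Finset σ) :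
    MvPolynomial σ k →ₐ[k] MvPolynomial σ k :=
  aeval fun l => if l ∈ U then 0 else X l

theorem killVars_X_of_mem {U : Finset σ} {l : σ} (h : l ∈ U) : killVars k U (X l) = 0 := by
  simp [killVars, h]

theorem killVars_X_of_notMem {U : Finset σ} {l : σ} (h : l ∉ U) : killVars k U (X l) = X l := by
  simp [killVars, h]

theorem sub_killVars_mem (U : Finset σ) (a : MvPolynomial σ k) :
    a - killVars k U a ∈ Ideal.span (X '' (U : Set σ)) := by
  rw [← Ideal.Quotient.mk_eq_mk_iff_sub_mem]
  refine DFunLike.congr_fun (?_ : Ideal.Quotient.mkₐ k (Ideal.span (X '' (U : Set σ))) =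
    (Ideal.Quotient.mkₐ k (Ideal.span (X '' (U : Set σ)))).comp (killVars k U)) a
  refine MvPolynomial.algHom_ext fun l => ?_
  by_cases hl : l ∈ U
  · rw [AlgHom.comp_apply, killVars_X_of_mem hl, map_zero]
    exact Ideal.Quotient.eq_zero_iff_mem.mpr (Ideal.subset_span ⟨l, hl, rfl⟩)
  · rw [AlgHom.comp_apply, killVars_X_of_notMem hl]

theorem killVars_eq_zero_of_mem_span {U V : Finset σ} (h : V ⊆ U) {a : MvPolynomial σ k}
    (ha : a ∈ Ideal.span (X '' (V : Set σ))) : killVars k U a = 0 := by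
  suffices Ideal.span (X '' (V : Set σ)) ≤ RingHom.ker (killVars k U) from this ha
  rw [Ideal.span_le]
  rintro _ ⟨l, hl, rfl⟩
  exact killVars_X_of_mem (h hl)

theorem mem_span_of_killVars_eq_zero {U : Finset σ} {a : MvPolynomial σ k}
    (ha : killVars k U a = 0) : a ∈ Ideal.span (X '' (U : Set σ)) := by
  simpa [ha] using sub_killVars_mem U a

theorem killVars_eq_zero_mono {U V : Finset σ} (h : V ⊆ U) {a : MvPolynomial σ k}
    (ha : killVars k V a = 0) : killVars k U a = 0 :=
  killVars_eq_zero_of_mem_span h (mem_span_of_killVars_eq_zero ha)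

theorem killVars_prod_X {U T : Finset σ} (h : Disjoint U T) :
    killVars k U (∏ l ∈ T, X l) = ∏ l ∈ T, X l := by
  rw [map_prod]
  exact Finset.prod_congr rfl fun l hl => killVars_X_of_notMem (Finset.disjoint_right.mp h hl)

theorem killVars_eq_zero_of_mem_sncIdeal {Z T : Finset σ} {a : MvPolynomial σ k}
    (ha : a ∈ sncIdeal k Z T) {j : σ} (hj : j ∈ T) : killVars k (insert j Z) a = 0 := by
  obtain ⟨b, hb⟩ := mem_sncIdeal_iff.mp ha
  have := killVars_eq_zero_of_mem_span (Finset.subset_insert j Z) hb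
  rwa [map_sub, map_mul, map_prod,
    Finset.prod_eq_zero hj (killVars_X_of_mem (Finset.mem_insert_self j Z)), mul_zero,
    sub_zero] at this

/-- A normal crossing divisor is the reduced union of its components. -/
theorem mem_sncIdeal_of_killVars_eq_zero {Z T : Finset σ} (hZT : Disjoint Z T)
    {a : MvPolynomial σ k} (ha : ∀ j ∈ T, killVars k (insert j Z) a = 0) :
    a ∈ sncIdeal k Z T := by
  induction T using Finset.induction_on with
  | empty => exact mem_sncIdeal_iff.mpr ⟨a, by simp⟩
  | insert j T hjT ih =>
    rw [Finset.disjoint_insert_right] at hZT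
    obtain ⟨b, hb⟩ := mem_sncIdeal_iff.mp
      (ih hZT.2 fun l hl => ha l (Finset.mem_insert_of_mem hl))
    have hb' := killVars_eq_zero_of_mem_span (Finset.subset_insert j Z) hb
    rw [map_sub, ha j (Finset.mem_insert_self j T), map_mul,
      killVars_prod_X (Finset.disjoint_insert_left.mpr ⟨hjT, hZT.2⟩), zero_sub, neg_eq_zero] at hb'
    have hbZ := mem_span_of_killVars_eq_zero
      ((mul_eq_zero.mp hb').resolve_right (prod_X_ne_zero T))
    rw [Finset.coe_insert, Set.image_insert_eq, Ideal.mem_span_insert'] at hbZ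
    obtain ⟨c, hc⟩ := hbZ
    refine mem_sncIdeal_iff.mpr ⟨-c, ?_⟩
    convert add_mem hb (Ideal.mul_mem_right (∏ l ∈ T, X l) _ hc) using 1
    rw [Finset.prod_insert hjT]
    ring

theorem mul_prod_erase_mem_sncIdeal {Z T : Finset σ} {a : MvPolynomial σ k} {j : σ} (hj : j ∈ T)
    (ha : killVars k (insert j Z) a = 0) : a * ∏ l ∈ T.erase j, X l ∈ sncIdeal k Z T := by
  have h := mem_span_of_killVars_eq_zero ha
  rw [Finset.coe_insert, Set.image_insert_eq, Ideal.mem_span_insert'] at h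
  obtain ⟨c, hc⟩ := h
  refine mem_sncIdeal_iff.mpr ⟨-c, ?_⟩
  convert Ideal.mul_mem_right (∏ l ∈ T.erase j, X l) _ hc using 1
  rw [← Finset.mul_prod_erase T X hj]
  ring

theorem killVars_prod_erase_ne_zero {Z T : Finset σ} (hZT : Disjoint Z T) (j : σ) :
    killVars k (insert j Z) (∏ l ∈ T.erase j, X l) ≠ 0 := by
  rw [killVars_prod_X]
  · exact prod_X_ne_zero _
  · exact Finset.disjoint_insert_left.mpr
      ⟨Finset.notMem_erase j T, hZT.mono_right (Finset.erase_subset j T)⟩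

variable {S : Type*} [CommRing S] [Algebra k S] {Z T : Finset σ}

/-- A nonzerodivisor on a normal crossing divisor does not vanish on any component. -/
theorem killVars_ne_zero_of_mem_nonZeroDivisors (hZT : Disjoint Z T)
    {f : MvPolynomial σ k →ₐ[k] S} (hker : ∀ a, f a = 0 ↔ a ∈ sncIdeal k Z T)
    {a : MvPolynomial σ k} (ha : f a ∈ nonZeroDivisors S) {j : σ} (hj : j ∈ T) :
    killVars k (insert j Z) a ≠ 0 := by
  intro h
  have hmul := (hker _).mpr (mul_prod_erase_mem_sncIdeal hj h)
  rw [map_mul] at hmul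
  exact killVars_prod_erase_ne_zero hZT j (killVars_eq_zero_of_mem_sncIdeal
    ((hker _).mp ((mul_left_mem_nonZeroDivisors_eq_zero_iff ha).mp hmul)) hj)

/-- The sum of the partial derivatives of `∏ l ∈ T, X l` is a nonzerodivisor on the normal crossing
divisor. -/
theorem sum_prod_erase_mem_nonZeroDivisors (hZT : Disjoint Z T)
    {f : MvPolynomial σ k →ₐ[k] S} (hf : Function.Surjective f)
    (hker : ∀ a, f a = 0 ↔ a ∈ sncIdeal k Z T) :
    f (∑ j ∈ T, ∏ l ∈ T.erase j, X l) ∈ nonZeroDivisors S := by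
  rw [mem_nonZeroDivisors_iff_right]
  intro s hs
  obtain ⟨a, rfl⟩ := hf s
  rw [← map_mul, hker] at hs
  refine (hker a).mpr (mem_sncIdeal_of_killVars_eq_zero hZT fun j hj => ?_)
  have h := killVars_eq_zero_of_mem_sncIdeal hs hj
  rw [map_mul, map_sum, Finset.sum_eq_single_of_mem j hj] at h
  · exact (mul_eq_zero.mp h).resolve_right (killVars_prod_erase_ne_zero hZT j)
  · intro m _ hmj
    rw [map_prod]
    exact Finset.prod_eq_zero (Finset.mem_erase.mpr ⟨hmj.symm, hj⟩)
      (killVars_X_of_mem (Finset.mem_insert_self j Z))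

end NormalCrossings

theorem Derivation.leibniz_finset_prod {R A M ι : Type*} [CommSemiring R] [CommSemiring A]
    [AddCommMonoid M] [Algebra R A] [Module A M] [Module R M] [DecidableEq ι]
    (d : Derivation R A M) (s : Finset ι) (f : ι → A) :
    d (∏ m ∈ s, f m) = ∑ m ∈ s, (∏ r ∈ s.erase m, f r) • d (f m) := by
  induction s using Finset.induction_on with
  | empty => simp
  | insert a s ha ih =>
    rw [Finset.prod_insert ha, d.leibniz, ih, Finset.sum_insert ha, Finset.erase_insert ha,
      Finset.smul_sum, add_comm]
    congr 1
    refine Finset.sum_congr rfl fun m hm => ?_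
    have hma : m ≠ a := fun h => ha (h ▸ hm)
    rw [smul_smul, Finset.erase_insert_of_ne hma.symm,
      Finset.prod_insert fun h => ha (Finset.mem_of_mem_erase h)]

theorem Module.Basis.repr_sum_smul_eq {R M ι : Type*} [Semiring R] [AddCommMonoid M] [Module R M]
    [Fintype ι] (b : Module.Basis ι R M) (c : ι → R) (w : ι → M) {j : ι} (hj : w j = b j)
    (h : ∀ m ≠ j, b.repr (w m) j = 0) : b.repr (∑ m, c m • w m) j = c j := by
  rw [map_sum, Finsupp.finsetSum_apply, Finset.sum_eq_single_of_mem j (Finset.mem_univ j)]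
  · simp [hj]
  · intro m _ hm
    simp [h m hm]

section FormsOnNormalCrossings

open KaehlerDifferential Set.powersetCard

variable {k : Type*} [Field k] {σ : Type*} [LinearOrder σ] {i : ℕ}
  {S : Type*} [CommRing S] [Algebra k S]

/-- The basis `dX_J`, `J ⊆ σ` with `i` elements, of the `i`-forms on affine space. -/
noncomputable def formBasis (k : Type*) [Field k] (σ : Type*) [LinearOrder σ] (i : ℕ) :
    Module.Basis (Set.powersetCard σ i) (MvPolynomial σ k) (OmegaPow k (MvPolynomial σ k) i) :=
  (mvPolynomialBasis k σ).exteriorPower i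

theorem formBasis_apply (J : Set.powersetCard σ i) :
    formBasis k σ i J =
      omegaGen k (MvPolynomial σ k) i 1 fun t => X (ofFinEmbEquiv.symm J t) := by
  rw [formBasis, exteriorPower.basis_apply, omegaGen_eq_smul_ιMulti, one_smul,
    exteriorPower.ιMulti_family]
  congr 1
  exact funext fun t => mvPolynomialBasis_apply k σ _

theorem exists_ofFinEmbEquiv_symm_eq {J : Set.powersetCard σ i} {l : σ} (hl : l ∈ J.val) :
    ∃ t, ofFinEmbEquiv.symm J t = l :=
  (mem_range_ofFinEmbEquiv_symm_iff_mem J l).mpr hl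

theorem ofFinEmbEquiv_symm_mem (J : Set.powersetCard σ i) (t : Fin i) :
    ofFinEmbEquiv.symm J t ∈ J.val :=
  (mem_range_ofFinEmbEquiv_symm_iff_mem J _).mp ⟨t, rfl⟩

theorem omegaMap_formBasis (f : MvPolynomial σ k →ₐ[k] S)
    (J : Set.powersetCard σ i) :
    omegaMap i f (formBasis k σ i J) =
      omegaGen k S i 1 fun t => f (X (ofFinEmbEquiv.symm J t)) := by
  rw [formBasis_apply, omegaMap_omegaGen, map_one]

theorem omegaMap_formBasis_eq_zero {f : MvPolynomial σ k →ₐ[k] S} {J : Set.powersetCard σ i}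
    {l : σ} (hl : l ∈ J.val) (hf : f (X l) = 0) :
    omegaMap i f (formBasis k σ i J) = 0 := by
  obtain ⟨t, rfl⟩ := exists_ofFinEmbEquiv_symm_eq hl
  rw [omegaMap_formBasis]
  exact omegaGen_eq_zero_of_eq_zero _ hf

theorem omegaMap_killVars_formBasis {U : Finset σ} {J : Set.powersetCard σ i}
    (hJ : Disjoint U J.val) : omegaMap i (killVars k U) (formBasis k σ i J) = formBasis k σ i J := by
  have h (t : Fin i) : killVars k U (X (ofFinEmbEquiv.symm J t)) = X (ofFinEmbEquiv.symm J t) :=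
    killVars_X_of_notMem (Finset.disjoint_right.mp hJ (ofFinEmbEquiv_symm_mem J t))
  rw [omegaMap_formBasis, formBasis_apply]
  simp only [h]

/-- Logarithmic forms, multiplied by the equation of the divisor, restrict to forms on the divisor
that are annihilated by every partial derivative of the equation. -/
theorem prod_erase_mul_prod_sdiff_smul_eq_zero {T : Finset σ} {f : MvPolynomial σ k →ₐ[k] S}
    (hT : f (∏ l ∈ T, X l) = 0)
    (J : Set.powersetCard σ i) {l : σ} (hl : l ∈ T) :
    f ((∏ m ∈ T.erase l, X m) * ∏ m ∈ T \ J.val, X m) • omegaMap i f (formBasis k σ i J) = 0 := by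
  have hdvd {m : σ} (hm : m ∈ T \ J.val) :
      f ((∏ r ∈ T.erase m, X r) * ∏ r ∈ T \ J.val, X r) = 0 := by
    refine zero_dvd_iff.mp (hT ▸ map_dvd f ?_)
    rw [← Finset.prod_erase_mul T X (Finset.mem_sdiff.mp hm).1]
    exact mul_dvd_mul_left _ (Finset.dvd_prod_of_mem X hm)
  by_cases hlJ : l ∈ J.val
  swap
  · rw [hdvd (Finset.mem_sdiff.mpr ⟨hl, hlJ⟩), zero_smul]
  obtain ⟨t, rfl⟩ := exists_ofFinEmbEquiv_symm_eq hlJ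
  set v : Fin i → Ω[S⁄k] := fun r => D k S (f (X (ofFinEmbEquiv.symm J r))) with hv
  have hD : ∑ m ∈ T, f (∏ r ∈ T.erase m, X r) • D k S (f (X m)) = 0 := by
    have := congrArg (D k S) hT
    rw [map_prod, Derivation.leibniz_finset_prod, map_zero] at this
    simpa only [map_prod] using this
  have hsum := (exteriorPower.ιMulti S i).map_update_sum T t
    (fun m => f (∏ r ∈ T.erase m, X r) • D k S (f (X m))) v
  rw [hD, AlternatingMap.map_update_zero] at hsum
  have hsmul := congrArg (f (∏ m ∈ T \ J.val, X m) • ·) hsum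
  simp only [AlternatingMap.map_update_smul, smul_zero, Finset.smul_sum, smul_smul,
    ← map_mul] at hsmul
  rw [Finset.sum_eq_single_of_mem _ hl] at hsmul
  · rw [omegaMap_formBasis, omegaGen_eq_smul_ιMulti, one_smul, mul_comm]
    refine Eq.trans ?_ hsmul.symm
    congr 2
    exact (Function.update_eq_self t v).symm
  · intro m hm hne
    by_cases hmJ : m ∈ J.val
    · obtain ⟨r, rfl⟩ := exists_ofFinEmbEquiv_symm_eq hmJ
      have hrt : r ≠ t := fun h => hne (by rw [h])
      rw [AlternatingMap.map_eq_zero_of_eq _ _ (i := r) (j := t) (by simp [hrt, hv]) hrt, smul_zero]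
    · rw [mul_comm, hdvd (Finset.mem_sdiff.mpr ⟨hm, hmJ⟩), zero_smul]

variable [Fintype σ]

theorem omegaMap_eq_sum (f : MvPolynomial σ k →ₐ[k] S) (ω : OmegaPow k (MvPolynomial σ k) i) :
    omegaMap i f ω =
      ∑ J, f ((formBasis k σ i).repr ω J) • omegaMap i f (formBasis k σ i J) := by
  conv_lhs => rw [← (formBasis k σ i).sum_repr ω]
  simp only [map_sum, omegaMap_smul]

theorem repr_omegaMap_killVars {U : Finset σ} (ω : OmegaPow k (MvPolynomial σ k) i)
    {J : Set.powersetCard σ i} (hJ : Disjoint U J.val) :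
    (formBasis k σ i).repr (omegaMap i (killVars k U) ω) J =
      killVars k U ((formBasis k σ i).repr ω J) := by
  rw [omegaMap_eq_sum]
  refine (formBasis k σ i).repr_sum_smul_eq _ _ (omegaMap_killVars_formBasis hJ) fun J' hJ' => ?_
  by_cases h : Disjoint U J'.val
  · rw [omegaMap_killVars_formBasis h, Module.Basis.repr_self,
      Finsupp.single_eq_of_ne hJ'.symm]
  · obtain ⟨l, hlU, hlJ⟩ := Finset.not_disjoint_iff.mp h
    rw [omegaMap_formBasis_eq_zero hlJ (killVars_X_of_mem hlU), map_zero, Finsupp.zero_apply]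

variable {Z T : Finset σ} {f : MvPolynomial σ k →ₐ[k] S} {ω : OmegaPow k (MvPolynomial σ k) i}

/-- A form on affine space whose restriction to a normal crossing divisor is torsion vanishes on
every component. -/
theorem killVars_repr_eq_zero_of_mem_torsion (hZT : Disjoint Z T) (hf : Function.Surjective f)
    (hker : ∀ a, f a = 0 ↔ a ∈ sncIdeal k Z T)
    (hω : omegaMap i f ω ∈ Submodule.torsion S (OmegaPow k S i))
    {J : Set.powersetCard σ i} (hJ : Disjoint Z J.val) {j : σ} (hjT : j ∈ T) (hjJ : j ∉ J.val) :
    killVars k (insert j Z) ((formBasis k σ i).repr ω J) = 0 := by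
  obtain ⟨⟨s, hs⟩, hsω⟩ := (Submodule.mem_torsion_iff _).mp hω
  obtain ⟨a, rfl⟩ := hf s
  have ha := killVars_ne_zero_of_mem_nonZeroDivisors hZT hker hs hjT
  let e : S →ₐ[k] MvPolynomial σ k := f.liftOfSurjective hf (killVars k (insert j Z))
    fun b hb => killVars_eq_zero_of_mem_sncIdeal ((hker b).mp hb) hjT
  have he : e.comp f = killVars k (insert j Z) := AlgHom.liftOfSurjective_comp ..
  have h := congrArg (omegaMap i e) hsω
  rw [Submonoid.mk_smul, omegaMap_smul, map_zero, omegaMap_comp, he, ← AlgHom.comp_apply, he] at h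
  have h' := DFunLike.congr_fun (congrArg (formBasis k σ i).repr h) J
  rw [LinearEquiv.map_smul, LinearEquiv.map_zero, Finsupp.smul_apply, Finsupp.zero_apply,
    repr_omegaMap_killVars ω (Finset.disjoint_insert_left.mpr ⟨hjJ, hJ⟩)] at h'
  exact (mul_eq_zero.mp h').resolve_left ha

theorem omegaMap_mem_torsion (hZT : Disjoint Z T) (hf : Function.Surjective f)
    (hker : ∀ a, f a = 0 ↔ a ∈ sncIdeal k Z T)
    (hω : ∀ J : Set.powersetCard σ i, Disjoint Z J.val → ∀ j ∈ T, j ∉ J.val →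
      killVars k (insert j Z) ((formBasis k σ i).repr ω J) = 0) :
    omegaMap i f ω ∈ Submodule.torsion S (OmegaPow k S i) := by
  rw [omegaMap_eq_sum]
  refine sum_mem fun J _ => ?_
  by_cases hJ : Disjoint Z J.val
  swap
  · obtain ⟨z, hzZ, hzJ⟩ := Finset.not_disjoint_iff.mp hJ
    rw [omegaMap_formBasis_eq_zero hzJ ((hker _).mpr (X_mem_sncIdeal T hzZ)), smul_zero]
    exact zero_mem _
  have hc : (formBasis k σ i).repr ω J ∈ sncIdeal k Z (T \ J.val) :=
    mem_sncIdeal_of_killVars_eq_zero (hZT.mono_right Finset.sdiff_subset) fun j hj =>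
      hω J hJ j (Finset.mem_sdiff.mp hj).1 (Finset.mem_sdiff.mp hj).2
  obtain ⟨b, hb⟩ := mem_sncIdeal_iff.mp hc
  have hb' := (hker _).mpr (Ideal.mem_sup_left hb)
  rw [map_sub, sub_eq_zero, map_mul] at hb'
  refine (Submodule.mem_torsion_iff _).mpr
    ⟨⟨_, sum_prod_erase_mem_nonZeroDivisors hZT hf hker⟩, ?_⟩
  rw [Submonoid.mk_smul, hb', mul_smul, smul_comm, map_sum, Finset.sum_smul,
    Finset.sum_eq_zero, smul_zero]
  intro l hl
  rw [smul_smul, ← map_mul]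
  exact prod_erase_mul_prod_sdiff_smul_eq_zero ((hker _).mpr (prod_X_mem_sncIdeal Z T)) J hl

/-- The kernel of the restriction of forms from affine space to torsion-free forms on a normal
crossing divisor. -/
theorem omegaMap_mem_torsion_iff (hZT : Disjoint Z T) (hf : Function.Surjective f)
    (hker : ∀ a, f a = 0 ↔ a ∈ sncIdeal k Z T) :
    omegaMap i f ω ∈ Submodule.torsion S (OmegaPow k S i) ↔
    ∀ J : Set.powersetCard σ i, Disjoint Z J.val → ∀ j ∈ T, j ∉ J.val →
      killVars k (insert j Z) ((formBasis k σ i).repr ω J) = 0 :=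
  ⟨fun h _ hJ _ hjT hjJ => killVars_repr_eq_zero_of_mem_torsion hZT hf hker h hJ hjT hjJ,
    omegaMap_mem_torsion hZT hf hker⟩

/-- The kernel of the restriction of forms from affine space to a coordinate hyperplane. -/
theorem omegaMap_eq_zero_iff {z : σ} (hf : Function.Surjective f)
    (hker : ∀ a, f a = 0 ↔ a ∈ sncIdeal k ∅ {z}) :
    omegaMap i f ω = 0 ↔
    ∀ J : Set.powersetCard σ i, z ∉ J.val → killVars k {z} ((formBasis k σ i).repr ω J) = 0 := by
  constructor
  · intro h J hJ
    exact killVars_repr_eq_zero_of_mem_torsion (Finset.disjoint_empty_left _) hf hker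
      (h ▸ zero_mem _) (Finset.disjoint_empty_left _) (Finset.mem_singleton_self z) hJ
  · intro h
    have hz : f (X z) = 0 := (hker _).mpr (by simpa using prod_X_mem_sncIdeal (k := k) ∅ {z})
    rw [omegaMap_eq_sum]
    refine Finset.sum_eq_zero fun J _ => ?_
    by_cases hJ : z ∈ J.val
    · rw [omegaMap_formBasis_eq_zero hJ hz, smul_zero]
    · have hc := mem_span_of_killVars_eq_zero (h J hJ)
      rw [Finset.coe_singleton, Set.image_singleton, Ideal.mem_span_singleton'] at hc
      obtain ⟨b, hb⟩ := hc
      rw [← hb, map_mul, hz, mul_zero, zero_smul]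

end FormsOnNormalCrossings

/-- Two subgroups `K₁`, `K₂` of `P` give an exact sequence
`0 → P / (K₁ ∩ K₂) → P / K₂ × P / K₁ → P / (K₁ + K₂) → 0`. -/
theorem AddMonoidHom.exists_exact_of_ker {P M M₁ M₂ M₁₂ : Type*} [AddCommGroup P] [AddCommGroup M]
    [AddCommGroup M₁] [AddCommGroup M₂] [AddCommGroup M₁₂] {q : P →+ M} {q₁ : P →+ M₁}
    {q₂ : P →+ M₂} {q₁₂ : P →+ M₁₂} (hq : Function.Surjective q) (hq₁ : Function.Surjective q₁)
    (hq₂ : Function.Surjective q₂) (hq₁₂ : Function.Surjective q₁₂)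
    (h : ∀ p, q p = 0 ↔ q₂ p = 0 ∧ q₁ p = 0)
    (h₁₂ : ∀ p, q₁₂ p = 0 ↔ ∃ a, q₂ a = 0 ∧ q₁ (p - a) = 0) :
    ∃ (φ : M →+ M₂ × M₁) (ψ : M₂ × M₁ →+ M₁₂), (∀ p, φ (q p) = (q₂ p, q₁ p)) ∧
      (∀ p, ψ (q₂ p, 0) = q₁₂ p) ∧ (∀ p, ψ (0, q₁ p) = -q₁₂ p) ∧
      Function.Injective φ ∧ Function.Exact φ ψ ∧ Function.Surjective ψ := by
  let φ : M →+ M₂ × M₁ := q.liftOfSurjective hq ⟨q₂.prod q₁, fun p hp =>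
    Prod.ext ((h p).mp hp).1 ((h p).mp hp).2⟩
  let r₂ : M₂ →+ M₁₂ := q₂.liftOfSurjective hq₂ ⟨q₁₂, fun p hp =>
    (h₁₂ p).mpr ⟨p, hp, by rw [sub_self, map_zero]⟩⟩
  let r₁ : M₁ →+ M₁₂ := q₁.liftOfSurjective hq₁ ⟨q₁₂, fun p hp =>
    (h₁₂ p).mpr ⟨0, map_zero _, by rwa [sub_zero]⟩⟩
  let ψ : M₂ × M₁ →+ M₁₂ := r₂.comp (AddMonoidHom.fst M₂ M₁) - r₁.comp (AddMonoidHom.snd M₂ M₁)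
  have hφ (p : P) : φ (q p) = (q₂ p, q₁ p) := q.liftOfRightInverse_comp_apply _ _ _ p
  have hr₂ (p : P) : r₂ (q₂ p) = q₁₂ p := q₂.liftOfRightInverse_comp_apply _ _ _ p
  have hr₁ (p : P) : r₁ (q₁ p) = q₁₂ p := q₁.liftOfRightInverse_comp_apply _ _ _ p
  have hψ (x : M₂) (y : M₁) : ψ (x, y) = r₂ x - r₁ y := rfl
  refine ⟨φ, ψ, hφ, fun p => by rw [hψ, hr₂, map_zero, sub_zero],
    fun p => by rw [hψ, hr₁, map_zero, zero_sub], ?_, ?_, ?_⟩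
  · refine (injective_iff_map_eq_zero φ).mpr fun m hm => ?_
    obtain ⟨p, rfl⟩ := hq m
    rw [hφ, Prod.mk_eq_zero] at hm
    exact (h p).mpr hm
  · rintro ⟨x, y⟩
    constructor
    · intro hxy
      obtain ⟨p, rfl⟩ := hq₂ x
      obtain ⟨p', rfl⟩ := hq₁ y
      rw [hψ, hr₂, hr₁, ← map_sub] at hxy
      obtain ⟨a, ha₂, ha₁⟩ := (h₁₂ _).mp hxy
      refine ⟨q (p - a), ?_⟩
      rw [hφ, map_sub q₂, ha₂, sub_zero]
      rw [sub_right_comm, map_sub, sub_eq_zero] at ha₁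
      rw [ha₁]
    · rintro ⟨m, hm⟩
      obtain ⟨p, rfl⟩ := hq m
      rw [← hm, hφ, hψ, hr₂, hr₁, sub_self]
  · intro w
    obtain ⟨p, rfl⟩ := hq₁₂ w
    exact ⟨(q₂ p, 0), by rw [hψ, hr₂, map_zero, sub_zero]⟩

section ExactSequence

variable {k : Type*} [Field k] {σ : Type*} [LinearOrder σ] [Fintype σ] {i : ℕ}

/-- A form vanishing on the strata `X z = X j = 0`, `j ∈ T`, is the sum of one vanishing on
`X j = 0`, `j ∈ T`, and one vanishing on `X z = 0`. -/
theorem killVars_repr_eq_zero_iff_exists {z : σ} {T : Finset σ} (hz : z ∉ T)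
    (ω : OmegaPow k (MvPolynomial σ k) i) :
    (∀ J : Set.powersetCard σ i, Disjoint {z} J.val → ∀ j ∈ T, j ∉ J.val →
      killVars k {j, z} ((formBasis k σ i).repr ω J) = 0) ↔
    ∃ η : OmegaPow k (MvPolynomial σ k) i,
      (∀ J : Set.powersetCard σ i, Disjoint ∅ J.val → ∀ j ∈ T, j ∉ J.val →
        killVars k (insert j ∅) ((formBasis k σ i).repr η J) = 0) ∧
      ∀ J : Set.powersetCard σ i, z ∉ J.val →
        killVars k {z} ((formBasis k σ i).repr (ω - η) J) = 0 := by
  constructor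
  · intro h
    have hc (J : Set.powersetCard σ i) : ∃ c : MvPolynomial σ k,
        (∀ j ∈ T, j ∉ J.val → killVars k {j} c = 0) ∧
        (z ∉ J.val → killVars k {z} ((formBasis k σ i).repr ω J - c) = 0) := by
      by_cases hzJ : z ∈ J.val
      · exact ⟨0, fun _ _ _ => map_zero _, fun h => (h hzJ).elim⟩
      · have hmem : (formBasis k σ i).repr ω J ∈ sncIdeal k {z} (T \ J.val) :=
          mem_sncIdeal_of_killVars_eq_zero
            (Finset.disjoint_singleton_left.mpr fun hzT => hz (Finset.mem_sdiff.mp hzT).1)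
            fun j hj => h J (Finset.disjoint_singleton_left.mpr hzJ) j
              (Finset.mem_sdiff.mp hj).1 (Finset.mem_sdiff.mp hj).2
        obtain ⟨b, hb⟩ := mem_sncIdeal_iff.mp hmem
        refine ⟨b * ∏ l ∈ T \ J.val, X l, fun j hjT hjJ => ?_,
          fun _ => killVars_eq_zero_of_mem_span subset_rfl hb⟩
        rw [map_mul, map_prod, Finset.prod_eq_zero (Finset.mem_sdiff.mpr ⟨hjT, hjJ⟩)
          (killVars_X_of_mem (Finset.mem_singleton_self j)), mul_zero]
    choose c hcT hcz using hc
    have hη (J : Set.powersetCard σ i) :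
        (formBasis k σ i).repr (∑ J, c J • formBasis k σ i J) J = c J :=
      congrFun ((formBasis k σ i).repr_sum_self c) J
    refine ⟨∑ J, c J • formBasis k σ i J, fun J _ j hjT hjJ => ?_, fun J hzJ => ?_⟩
    · rw [hη]
      exact hcT J j hjT hjJ
    · rw [map_sub, Finsupp.sub_apply, hη]
      exact hcz J hzJ
  · rintro ⟨η, hη, hωη⟩ J hJ j hjT hjJ
    rw [← sub_add_cancel ω η, map_add, Finsupp.add_apply, map_add,
      killVars_eq_zero_mono (by simp) (hωη J (Finset.disjoint_singleton_left.mp hJ)),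
      killVars_eq_zero_mono (by simp) (hη J (Finset.disjoint_empty_left _) j hjT hjJ), add_zero]

/-- The Mayer–Vietoris sequence of torsion-free forms on the normal crossing divisor with
components `z` and `T`. -/
theorem exists_exact_omegaPowModTors {z : σ} {T : Finset σ} (hz : z ∉ T) {S S₁ S₂ S₁₂ : Type*}
    [CommRing S] [CommRing S₁] [CommRing S₂] [CommRing S₁₂] [Algebra k S] [Algebra k S₁]
    [Algebra k S₂] [Algebra k S₁₂] {f : MvPolynomial σ k →ₐ[k] S} {f₁ : MvPolynomial σ k →ₐ[k] S₁}
    {f₂ : MvPolynomial σ k →ₐ[k] S₂} {f₁₂ : MvPolynomial σ k →ₐ[k] S₁₂}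
    (hf : Function.Surjective f) (hf₁ : Function.Surjective f₁) (hf₂ : Function.Surjective f₂)
    (hf₁₂ : Function.Surjective f₁₂) (hker : ∀ a, f a = 0 ↔ a ∈ sncIdeal k ∅ (insert z T))
    (hker₁ : ∀ a, f₁ a = 0 ↔ a ∈ sncIdeal k ∅ {z}) (hker₂ : ∀ a, f₂ a = 0 ↔ a ∈ sncIdeal k ∅ T)
    (hker₁₂ : ∀ a, f₁₂ a = 0 ↔ a ∈ sncIdeal k {z} T) :
    ∃ (φ : OmegaPowModTors k S i →+ OmegaPowModTors k S₂ i × OmegaPow k S₁ i)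
      (ψ : OmegaPowModTors k S₂ i × OmegaPow k S₁ i →+ OmegaPowModTors k S₁₂ i),
      (∀ ω, φ (omegaMapModTors i f ω) = (omegaMapModTors i f₂ ω, omegaMap i f₁ ω)) ∧
      (∀ ω, ψ (omegaMapModTors i f₂ ω, 0) = omegaMapModTors i f₁₂ ω) ∧
      (∀ ω, ψ (0, omegaMap i f₁ ω) = -omegaMapModTors i f₁₂ ω) ∧
      Function.Injective φ ∧ Function.Exact φ ψ ∧ Function.Surjective ψ := by
  refine AddMonoidHom.exists_exact_of_ker (omegaMapModTors_surjective hf)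
    (omegaMap_surjective hf₁) (omegaMapModTors_surjective hf₂) (omegaMapModTors_surjective hf₁₂)
    (fun ω => ?_) (fun ω => ?_)
  · rw [omegaMapModTors_eq_zero_iff, omegaMapModTors_eq_zero_iff,
      omegaMap_mem_torsion_iff (Finset.disjoint_empty_left _) hf hker,
      omegaMap_mem_torsion_iff (Finset.disjoint_empty_left _) hf₂ hker₂,
      omegaMap_eq_zero_iff hf₁ hker₁]
    constructor
    · exact fun h => ⟨fun J hJ j hj => h J hJ j (Finset.mem_insert_of_mem hj),
        fun J => h J (Finset.disjoint_empty_left _) z (Finset.mem_insert_self z T)⟩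
    · rintro ⟨h₂, h₁⟩ J hJ j hj hjJ
      rcases Finset.mem_insert.mp hj with rfl | hj
      · exact h₁ J hjJ
      · exact h₂ J hJ j hj hjJ
  · simp only [omegaMapModTors_eq_zero_iff,
      omegaMap_mem_torsion_iff (Finset.disjoint_singleton_left.mpr hz) hf₁₂ hker₁₂,
      omegaMap_mem_torsion_iff (Finset.disjoint_empty_left _) hf₂ hker₂,
      omegaMap_eq_zero_iff hf₁ hker₁]
    exact killVars_repr_eq_zero_iff_exists hz ω

end ExactSequence

/-- **Appendix Theorem (differential forms on simple normal crossing schemes).**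
For every `i ≥ 1` the sequence of `A`-modules
`0 → Ω^i_R/tors → (Ω^i_{R₂}/tors) ⊕ Ω^i_{R₁} → Ω^i_{R₁₂}/tors → 0`
is exact, where the first map `φ` is the pair of canonical restriction maps (induced by the
quotients `R → R₂` and `R → R₁`) and the second map `ψ` sends a pair `(ω, η)` to the
difference of their canonical restrictions to `Ω^i_{R₁₂}/tors`.  The maps `φ` and `ψ` are
pinned down by their values on the generators `a₀ • (d a₁ ∧ ⋯ ∧ d a_i)` (images of elements
of `A`), which generate the modules in question; exactness of the sequence is expressed by
`Function.Injective φ`, `Function.Exact φ ψ` and `Function.Surjective ψ`. -/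
theorem stmt4 (k : Type*) [Field k] (n i : ℕ) (hi : 1 ≤ i) :
    ∃ (φ : OmegaPowModTors k (ringR k n) i →+
        (OmegaPowModTors k (ringR2 k n) i) × (OmegaPow k (ringR1 k n) i))
      (ψ : (OmegaPowModTors k (ringR2 k n) i) × (OmegaPow k (ringR1 k n) i) →+
        OmegaPowModTors k (ringR12 k n) i),
      (∀ (a₀ : polyA k n) (v : Fin i → polyA k n),
        φ (omegaGenTors k (ringR k n) i (Ideal.Quotient.mk (idealR k n) a₀)
            fun t => Ideal.Quotient.mk (idealR k n) (v t))
          = (omegaGenTors k (ringR2 k n) i (Ideal.Quotient.mk (idealR2 k n) a₀)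
               fun t => Ideal.Quotient.mk (idealR2 k n) (v t),
             omegaGen k (ringR1 k n) i (Ideal.Quotient.mk (idealR1 k n) a₀)
               fun t => Ideal.Quotient.mk (idealR1 k n) (v t))) ∧
      (∀ (a₀ : polyA k n) (v : Fin i → polyA k n),
        ψ (omegaGenTors k (ringR2 k n) i (Ideal.Quotient.mk (idealR2 k n) a₀)
             fun t => Ideal.Quotient.mk (idealR2 k n) (v t), 0)
          = omegaGenTors k (ringR12 k n) i (Ideal.Quotient.mk (idealR12 k n) a₀)
              fun t => Ideal.Quotient.mk (idealR12 k n) (v t)) ∧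
      (∀ (a₀ : polyA k n) (v : Fin i → polyA k n),
        ψ (0, omegaGen k (ringR1 k n) i (Ideal.Quotient.mk (idealR1 k n) a₀)
             fun t => Ideal.Quotient.mk (idealR1 k n) (v t))
          = - omegaGenTors k (ringR12 k n) i (Ideal.Quotient.mk (idealR12 k n) a₀)
              fun t => Ideal.Quotient.mk (idealR12 k n) (v t)) ∧
      Function.Injective φ ∧ Function.Exact φ ψ ∧ Function.Surjective ψ := by
  have hinsert : insert 0 (Finset.univ.erase 0) = (Finset.univ : Finset (Fin (n + 1))) :=
    Finset.insert_erase (Finset.mem_univ 0)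
  have hsurj (I : Ideal (polyA k n)) : Function.Surjective (Ideal.Quotient.mkₐ k I) :=
    Ideal.Quotient.mkₐ_surjective k I
  have hker {I : Ideal (polyA k n)} {Z T : Finset (Fin (n + 1))} (hI : I = sncIdeal k Z T)
      (a : polyA k n) : Ideal.Quotient.mkₐ k I a = 0 ↔ a ∈ sncIdeal k Z T := by
    rw [← hI]
    exact Ideal.Quotient.eq_zero_iff_mem
  obtain ⟨φ, ψ, hφ, hψ₂, hψ₁, hexact⟩ := exists_exact_omegaPowModTors (i := i)
    (Finset.notMem_erase (0 : Fin (n + 1)) Finset.univ)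
    (hsurj (idealR k n)) (hsurj (idealR1 k n)) (hsurj (idealR2 k n)) (hsurj (idealR12 k n))
    (hker (by rw [hinsert]; simp [sncIdeal])) (hker (by simp [sncIdeal]))
    (hker (by simp [sncIdeal])) (hker (by simp [sncIdeal, Ideal.span_insert]))
  refine ⟨φ, ψ, fun a₀ v => ?_, fun a₀ v => ?_, fun a₀ v => ?_, hexact⟩
  · have h := hφ (omegaGen k _ i a₀ v)
    rw [omegaMapModTors_omegaGen, omegaMapModTors_omegaGen, omegaMap_omegaGen] at h
    exact h
  · have h := hψ₂ (omegaGen k _ i a₀ v)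
    rw [omegaMapModTors_omegaGen, omegaMapModTors_omegaGen] at h
    exact h
  · have h := hψ₁ (omegaGen k _ i a₀ v)
    rw [omegaMapModTors_omegaGen, omegaMap_omegaGen] at h
    exact h
end

section
/- Let k be a field, n ≥ 1, A = k[x₁,…,xₙ], and R = A/(x₁x₂⋯xₙ). For i ≥ 1, the kernel of the canonical surjective A-linear map from Λ^i_A Ω_{A/k} (the i-th exterior power over A of the Kähler differentials of A) to Ω^i_R/tors (the i-th exterior power over R of Ω_{R/k}, modulo its torsion submodule) equals the A-submodule of Λ^i_A Ω_{A/k} generated by the elements (∏_{j ∉ {a₁,…,a_i}} x_j)·dx_{a₁}∧⋯∧dx_{a_i}, where (a₁,…,a_i) ranges over all tuples with 1 ≤ a₁ < ⋯ < a_i ≤ n and the product is over all indices j ∈ {1,…,n} not among the a's. Equivalently, Ω^i_R/tors ≅ Ω^i_A / (⊕_{a} A·x_{a^c}·dx_a). -/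
set_option maxHeartbeats 1000000
set_option synthInstance.maxHeartbeats 400000

open ExteriorAlgebra MvPolynomial

section ExteriorKaehler

variable (k : Type*) [CommRing k] {A B : Type*} [CommRing A] [CommRing B] [Algebra k A]
  [Algebra k B] [Algebra A B] [IsScalarTower k A B] (i : ℕ)

lemma omegaGen_eq (S : Type*) [CommRing S] [Algebra k S] (s₀ : S) (v : Fin i → S) :
    omegaGen k S i s₀ v =
      s₀ • exteriorPower.ιMulti S i (fun t => KaehlerDifferential.D k S (v t)) :=
  rfl

variable (A B) in
/-- The pullback `Ω^i_A → Ω^i_B` along `A → B`, as an `A`-linear map. -/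
noncomputable def omegaPowMap : OmegaPow k A i →ₗ[A] OmegaPow k B i :=
  exteriorPower.alternatingMapLinearEquiv
    { toMultilinearMap :=
        ((exteriorPower.ιMulti B i (M := Ω[B⁄k])).toMultilinearMap.restrictScalars
          A).compLinearMap fun _ => KaehlerDifferential.map k k A B
      map_eq_zero_of_eq' := fun _ _ _ h hst =>
        (exteriorPower.ιMulti B i (M := Ω[B⁄k])).map_eq_zero_of_eq _
          (congrArg (KaehlerDifferential.map k k A B) h) hst }

lemma omegaPowMap_ιMulti (v : Fin i → Ω[A⁄k]) :
    omegaPowMap k A B i (exteriorPower.ιMulti A i v) =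
      exteriorPower.ιMulti B i fun t => KaehlerDifferential.map k k A B (v t) :=
  exteriorPower.alternatingMapLinearEquiv_apply_ιMulti _ _

lemma omegaPowMap_omegaGen (a₀ : A) (v : Fin i → A) :
    omegaPowMap k A B i (omegaGen k A i a₀ v) =
      omegaGen k B i (algebraMap A B a₀) fun t => algebraMap A B (v t) := by
  simp only [omegaGen_eq, map_smul, omegaPowMap_ιMulti, KaehlerDifferential.map_D,
    algebraMap_smul]

lemma omegaPowMap_surjective (h : Function.Surjective (algebraMap A B)) :
    Function.Surjective (omegaPowMap k A B i) := by
  rw [← LinearMap.range_eq_top, _root_.eq_top_iff, ← @Submodule.restrictScalars_top A B,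
    ← exteriorPower.ιMulti_span B i (M := Ω[B⁄k]), Submodule.restrictScalars_span _ _ h,
    Submodule.span_le]
  rintro _ ⟨v, rfl⟩
  choose u hu using fun t => KaehlerDifferential.map_surjective_of_surjective k k A B h (v t)
  exact ⟨exteriorPower.ιMulti A i u, by simp only [omegaPowMap_ιMulti, hu]⟩

end ExteriorKaehler

lemma Derivation.map_finset_prod {R A M ι : Type*} [CommSemiring R] [CommSemiring A]
    [AddCommMonoid M] [Algebra R A] [Module A M] [Module R M] [DecidableEq ι]
    (D : Derivation R A M) (s : Finset ι) (f : ι → A) :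
    D (∏ j ∈ s, f j) = ∑ j ∈ s, (∏ l ∈ s.erase j, f l) • D (f j) := by
  induction s using Finset.induction_on with
  | empty => simp
  | insert a s ha ih =>
    rw [Finset.prod_insert ha, D.leibniz, ih, Finset.sum_insert ha, Finset.erase_insert ha,
      Finset.smul_sum, add_comm]
    congr 1
    refine Finset.sum_congr rfl fun j hj => ?_
    have hja : a ≠ j := fun h => ha (h ▸ hj)
    rw [Finset.erase_insert_of_ne hja, Finset.prod_insert (by simp [ha]), mul_smul]

section NormalCrossing

variable (k : Type*) [Field k] (n i : ℕ)

/-- The derivative `∑ⱼ ∏_{l ≠ j} x_l` of the equation of `E` along `(1, …, 1)`; its class in `R`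
is a nonzerodivisor. -/
noncomputable def sumCofactors : polyA k n :=
  ∑ j, ∏ l ∈ Finset.univ.erase j, X l

variable {k n} in
lemma prod_X_dvd {s : Finset (Fin (n + 1))} {h : polyA k n} (H : ∀ j ∈ s, X j ∣ h) :
    ∏ j ∈ s, (X j : polyA k n) ∣ h := by
  refine Finset.prod_dvd_of_isRelPrime (fun a _ b _ hab => ?_) H
  refine (X_prime (i := a)).irreducible.isRelPrime_iff_not_dvd.2 fun hd => hab ?_
  simpa [X_dvd_X] using hd

lemma not_X_dvd_prod_erase (j : Fin (n + 1)) :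
    ¬ (X j : polyA k n) ∣ ∏ l ∈ Finset.univ.erase j, X l := by
  rw [(X_prime (i := j)).dvd_finsetProd_iff]
  rintro ⟨l, hl, hd⟩
  exact (Finset.ne_of_mem_erase hl) (by simpa [X_dvd_X, eq_comm] using hd)

lemma mk_eq_zero_iff (h : polyA k n) :
    Ideal.Quotient.mk (idealR k n) h = 0 ↔ ∏ j, X j ∣ h := by
  rw [Ideal.Quotient.eq_zero_iff_mem, Ideal.mem_span_singleton]

lemma mk_sumCofactors_mem_nonZeroDivisors :
    Ideal.Quotient.mk (idealR k n) (sumCofactors k n) ∈ nonZeroDivisors (ringR k n) := by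
  rw [mem_nonZeroDivisors_iff_right]
  intro y hy
  obtain ⟨h, rfl⟩ := Ideal.Quotient.mk_surjective y
  rw [← map_mul, mk_eq_zero_iff] at hy
  rw [mk_eq_zero_iff]
  refine prod_X_dvd fun j hj => ?_
  have hd : X j ∣ h * sumCofactors k n := (Finset.dvd_prod_of_mem _ hj).trans hy
  refine ((X_prime (i := j)).dvd_or_dvd hd).resolve_right fun hs => ?_
  rw [sumCofactors, ← Finset.add_sum_erase _ _ hj] at hs
  refine not_X_dvd_prod_erase k n j ((dvd_add_left (Finset.dvd_sum fun l hl => ?_)).1 hs)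
  exact Finset.dvd_prod_of_mem _ (by simpa using (Finset.ne_of_mem_erase hl).symm)

/-- The relation `d(x₁ ⋯ xₙ) = 0` in `Ω_R`. -/
lemma sum_cofactor_smul_D_eq_zero :
    ∑ j, Ideal.Quotient.mk (idealR k n) (∏ l ∈ Finset.univ.erase j, X l) •
      KaehlerDifferential.D k (ringR k n) (Ideal.Quotient.mk (idealR k n) (X j)) = 0 := by
  have h0 : Ideal.Quotient.mk (idealR k n) (∏ j, X j) = 0 := (mk_eq_zero_iff k n _).2 dvd_rfl
  have h1 := congrArg (KaehlerDifferential.D k (ringR k n)) h0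
  rw [map_zero, map_prod, Derivation.map_finset_prod] at h1
  simpa only [map_prod] using h1

lemma mk_cofactor_mul_eq_zero {a : Fin i → Fin (n + 1)} {l : Fin (n + 1)}
    (hl : l ∉ Set.range a) :
    Ideal.Quotient.mk (idealR k n) (∏ m ∈ Finset.univ.erase l, X m) *
      Ideal.Quotient.mk (idealR k n) (∏ j ∈ Finset.univ \ Finset.image a Finset.univ, X j) = 0 := by
  rw [← map_mul, mk_eq_zero_iff, ← Finset.prod_erase_mul _ _ (Finset.mem_univ l)]
  exact mul_dvd_mul_left _ (Finset.dvd_prod_of_mem _ (by simpa using hl))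

lemma smul_smul_eq_zero_of_mul {R M : Type*} [MonoidWithZero R] [Zero M] [MulActionWithZero R M]
    {r s : R} (h : r * s = 0) (m : M) : r • s • m = 0 := by
  rw [smul_smul, h, zero_smul]

/-- Each `x_{aᶜ} dx_a` is annihilated by `sumCofactors` in `Ω^i_R`. -/
lemma sumCofactors_smul_omegaGen (a : Fin i → Fin (n + 1)) :
    Ideal.Quotient.mk (idealR k n) (sumCofactors k n) • omegaGen k (ringR k n) i
      (Ideal.Quotient.mk (idealR k n) (∏ j ∈ Finset.univ \ Finset.image a Finset.univ, X j))
      (fun t => Ideal.Quotient.mk (idealR k n) (X (a t))) = 0 := by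
  rw [omegaGen_eq, sumCofactors, map_sum, Finset.sum_smul]
  refine Finset.sum_eq_zero fun j _ => ?_
  by_cases hj : j ∈ Set.range a
  · obtain ⟨t, rfl⟩ := hj
    have h := congrArg (fun ω => Ideal.Quotient.mk (idealR k n)
        (∏ j ∈ Finset.univ \ Finset.image a Finset.univ, X j) •
      exteriorPower.ιMulti (ringR k n) i (Function.update (fun t => KaehlerDifferential.D k
        (ringR k n) (Ideal.Quotient.mk (idealR k n) (X (a t)))) t ω))
      (sum_cofactor_smul_D_eq_zero k n)
    simp only [AlternatingMap.map_update_sum, AlternatingMap.map_update_smul,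
      AlternatingMap.map_update_zero, smul_zero, Finset.smul_sum] at h
    rw [Finset.sum_eq_single (a t), Function.update_eq_self, smul_comm] at h
    · exact h
    · intro l _ hl
      by_cases hla : l ∈ Set.range a
      · obtain ⟨u, rfl⟩ := hla
        have hut : u ≠ t := fun h => hl (h ▸ rfl)
        rw [AlternatingMap.map_eq_zero_of_eq _ _ (i := u) (j := t) (by simp [hut]) hut,
          smul_zero, smul_zero]
      · rw [smul_comm]
        exact smul_smul_eq_zero_of_mul (mk_cofactor_mul_eq_zero k n i hla) _
    · simp
  · exact smul_smul_eq_zero_of_mul (mk_cofactor_mul_eq_zero k n i hj) _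

lemma mk_X_smul_pderiv_eq_zero (l : Fin (n + 1)) (p : polyA k n)
    (hp : Ideal.Quotient.mkₐ k (idealR k n) p = 0) :
    Ideal.Quotient.mkₐ k (idealR k n) (((X l : polyA k n) • pderiv l) p) = 0 := by
  rw [Ideal.Quotient.mkₐ_eq_mk, mk_eq_zero_iff] at hp ⊢
  obtain ⟨y, rfl⟩ := hp
  simp only [Derivation.smul_apply, Derivation.leibniz, smul_eq_mul]
  refine dvd_add (dvd_mul_right _ _) ?_
  rw [← Finset.prod_erase_mul _ _ (Finset.mem_univ l), Derivation.leibniz]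
  have h0 : pderiv l (∏ m ∈ Finset.univ.erase l, (X m : polyA k n)) = 0 := by
    rw [Derivation.map_finset_prod]
    refine Finset.sum_eq_zero fun j hj => ?_
    rw [pderiv_X_of_ne (Finset.ne_of_mem_erase hj), smul_zero]
  rw [h0, pderiv_X_self, smul_eq_mul, smul_zero]
  exact ⟨y, by ring⟩

/-- The logarithmic derivation `x_l ∂/∂x_l` of `R`. -/
noncomputable def logDerivation (l : Fin (n + 1)) : Derivation k (ringR k n) (ringR k n) :=
  Derivation.liftOfSurjective (f := Ideal.Quotient.mkₐ k (idealR k n))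
    (Ideal.Quotient.mkₐ_surjective k _) (mk_X_smul_pderiv_eq_zero k n l)

lemma logDerivation_mk (l : Fin (n + 1)) (p : polyA k n) :
    logDerivation k n l (Ideal.Quotient.mk (idealR k n) p) =
      Ideal.Quotient.mk (idealR k n) (X l * pderiv l p) :=
  Derivation.liftOfSurjective_apply (Ideal.Quotient.mkₐ_surjective k _)
    (mk_X_smul_pderiv_eq_zero k n l) p

lemma logDerivation_lift_map (l : Fin (n + 1)) (ω : Ω[polyA k n⁄k]) :
    (logDerivation k n l).liftKaehlerDifferential
        (KaehlerDifferential.map k k (polyA k n) (ringR k n) ω) =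
      Ideal.Quotient.mk (idealR k n)
        (X l * (KaehlerDifferential.mvPolynomialBasis k (Fin (n + 1))).coord l ω) := by
  have hω : ω ∈ Submodule.span (polyA k n) (Set.range (KaehlerDifferential.D k (polyA k n))) := by
    rw [KaehlerDifferential.span_range_derivation]; trivial
  induction hω using Submodule.span_induction with
  | mem x hx =>
    obtain ⟨p, rfl⟩ := hx
    rw [KaehlerDifferential.map_D, Derivation.liftKaehlerDifferential_comp_D,
      Ideal.Quotient.algebraMap_eq, logDerivation_mk, Module.Basis.coord_apply,
      KaehlerDifferential.mvPolynomialBasis_repr_apply]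
  | zero => simp
  | add x y _ _ hx hy => simp only [map_add, mul_add, hx, hy]
  | smul c x _ hx =>
    rw [map_smul, LinearMap.map_smul_of_tower, hx, map_smul, smul_eq_mul, mul_left_comm]
    rfl

/-- Pairing with the logarithmic derivations `x_l ∂/∂x_l`, `l ∈ a`, sends the image of `w` in
`Ω^i_R` to `x_a` times the `dx_a`-coordinate of `w`. -/
lemma pairing_logDerivation_omegaPowMap (s : Set.powersetCard (Fin (n + 1)) i)
    (w : OmegaPow k (polyA k n) i) :
    exteriorPower.alternatingMapToDual (ringR k n) _ i
        (fun t => (logDerivation k n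
          (Set.powersetCard.ofFinEmbEquiv.symm s t)).liftKaehlerDifferential)
        (omegaPowMap k (polyA k n) (ringR k n) i w) =
      Ideal.Quotient.mk (idealR k n) ((∏ t, X (Set.powersetCard.ofFinEmbEquiv.symm s t)) *
        ((KaehlerDifferential.mvPolynomialBasis k (Fin (n + 1))).exteriorPower i).repr w s) := by
  have hw : w ∈ Submodule.span (polyA k n) (Set.range (exteriorPower.ιMulti (polyA k n) i)) := by
    rw [exteriorPower.ιMulti_span]; trivial
  induction hw using Submodule.span_induction with
  | mem x hx =>
    obtain ⟨v, rfl⟩ := hx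
    rw [omegaPowMap_ιMulti, exteriorPower.alternatingMapToDual_apply_ιMulti,
      exteriorPower.basis_repr_apply, exteriorPower.ιMultiDual_apply_ιMulti,
      ← Matrix.det_mul_row, RingHom.map_det]
    congr 1
    ext u t
    simp only [Matrix.of_apply, RingHom.mapMatrix_apply, Matrix.map_apply,
      logDerivation_lift_map]
  | zero => simp
  | add x y _ _ hx hy => simp only [map_add, mul_add, hx, hy, Finsupp.add_apply]
  | smul c x _ hx =>
    rw [map_smul, LinearMap.map_smul_of_tower, hx, map_smul, Finsupp.smul_apply, smul_eq_mul,
      mul_left_comm]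
    rfl

/-- If the image of `w` in `Ω^i_R` is torsion, then `x_{aᶜ}` divides its `dx_a`-coordinate. -/
lemma prod_compl_dvd_repr_of_mem_torsion (s : Set.powersetCard (Fin (n + 1)) i)
    {w : OmegaPow k (polyA k n) i}
    (hw : omegaPowMap k (polyA k n) (ringR k n) i w ∈
      Submodule.torsion (ringR k n) (OmegaPow k (ringR k n) i)) :
    ∏ j ∈ Finset.univ \ Finset.image (Set.powersetCard.ofFinEmbEquiv.symm s) Finset.univ, X j ∣
      ((KaehlerDifferential.mvPolynomialBasis k (Fin (n + 1))).exteriorPower i).repr w s := by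
  obtain ⟨⟨r, hr⟩, hrw⟩ := hw
  have h := congrArg (exteriorPower.alternatingMapToDual (ringR k n) _ i
    (fun t => (logDerivation k n
      (Set.powersetCard.ofFinEmbEquiv.symm s t)).liftKaehlerDifferential)) hrw
  rw [Submonoid.mk_smul, map_smul, pairing_logDerivation_omegaPowMap, map_zero, smul_eq_mul] at h
  have h' := (mk_eq_zero_iff k n _).1 ((mem_nonZeroDivisors_iff_left.1 hr) _ h)
  rw [← Finset.prod_sdiff (Finset.subset_univ
    (Finset.image (Set.powersetCard.ofFinEmbEquiv.symm s) Finset.univ)), mul_comm,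
    Finset.prod_image (Set.powersetCard.ofFinEmbEquiv.symm s).injective.injOn] at h'
  exact (mul_dvd_mul_iff_left (Finset.prod_ne_zero_iff.2 fun _ _ => X_ne_zero _)).1 h'

end NormalCrossing

/-- **Presentation (2) of the appendix.**  For `i ≥ 1`, the kernel of the canonical
surjective (`A`-linear) map `Ω^i_A → Ω^i_R/tors` equals the `A`-submodule of
`Ω^i_A = ⋀^i_A Ω_{A/k}` generated by the elements
`(∏_{j ∉ {a₁,…,a_i}} x_j) · dx_{a₁} ∧ ⋯ ∧ dx_{a_i}` for all strictly increasing tuples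
`a : Fin i → Fin (n+1)`; equivalently, `Ω^i_R/tors ≅ Ω^i_A / (⊕_a A·x_{aᶜ}·dx_a)`.
The canonical map `φ` is pinned down by its values on the generators
`a₀ • (d a₁ ∧ ⋯ ∧ d a_i)`, which generate `Ω^i_A`. -/
theorem stmt7 (k : Type*) [Field k] (n i : ℕ) (hi : 1 ≤ i) :
    ∃ φ : OmegaPow k (polyA k n) i →+ OmegaPowModTors k (ringR k n) i,
      (∀ (a₀ : polyA k n) (v : Fin i → polyA k n),
        φ (omegaGen k (polyA k n) i a₀ v)
          = omegaGenTors k (ringR k n) i (Ideal.Quotient.mk (idealR k n) a₀)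
              fun t => Ideal.Quotient.mk (idealR k n) (v t)) ∧
      Function.Surjective φ ∧
      (∀ w : OmegaPow k (polyA k n) i,
        φ w = 0 ↔
          w ∈ Submodule.span (polyA k n)
            {w : OmegaPow k (polyA k n) i | ∃ a : Fin i → Fin (n + 1), StrictMono a ∧
              w = omegaGen k (polyA k n) i
                    (∏ j ∈ Finset.univ \ Finset.image a Finset.univ, X j)
                    (fun t => X (a t))}) := by
  refine ⟨(Submodule.mkQ _).toAddMonoidHom.comp
    (omegaPowMap k (polyA k n) (ringR k n) i).toAddMonoidHom, fun a₀ v => ?_, ?_, fun w => ?_⟩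
  · exact congrArg (Submodule.mkQ _) (omegaPowMap_omegaGen k i a₀ v)
  · exact (Submodule.mkQ_surjective _).comp
      (omegaPowMap_surjective k i Ideal.Quotient.mk_surjective)
  · refine (Submodule.Quotient.mk_eq_zero _ (x := omegaPowMap k _ _ i w)).trans
      ⟨fun hw => ?_, fun hw => ?_⟩
    · rw [← ((KaehlerDifferential.mvPolynomialBasis k (Fin (n + 1))).exteriorPower i).sum_repr w]
      refine Submodule.sum_mem _ fun s _ => ?_
      obtain ⟨q, hq⟩ := prod_compl_dvd_repr_of_mem_torsion k n i s hw
      rw [hq, mul_comm, mul_smul]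
      refine Submodule.smul_mem _ q (Submodule.subset_span
        ⟨Set.powersetCard.ofFinEmbEquiv.symm s, OrderEmbedding.strictMono _, ?_⟩)
      rw [omegaGen_eq, exteriorPower.basis_apply, exteriorPower.ιMulti_family]
      congr 2
      ext1 t
      exact KaehlerDifferential.mvPolynomialBasis_apply k _ _
    · induction hw using Submodule.span_induction with
      | mem x hx =>
        obtain ⟨a, -, rfl⟩ := hx
        refine ⟨⟨_, mk_sumCofactors_mem_nonZeroDivisors k n⟩, ?_⟩
        exact (congrArg _ (omegaPowMap_omegaGen k i _ _)).trans
          (sumCofactors_smul_omegaGen k n i a)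
      | zero => rw [map_zero]; exact Submodule.zero_mem _
      | add x y _ _ hx hy => rw [map_add]; exact Submodule.add_mem _ hx hy
      | smul c x _ hx =>
        rw [map_smul, ← algebraMap_smul (ringR k n)]
        exact Submodule.smul_mem _ _ hx
end

section
/- Let A be a commutative ring and C• a bounded cochain complex of A-modules such that for every index j, the boundary module B^j := im(d^{j-1} : C^{j-1} → C^j) and the cohomology module H^j(C•) := ker(d^j)/im(d^{j-1}) are flat A-modules (for instance free A-modules). Then for every A-module M and every j, the natural map H^j(C•) ⊗_A M → H^j(C• ⊗_A M) is an isomorphism. In particular, if all terms, images and kernels of the differentials, and all cohomology modules of C• are free over A, then cohomology of C• commutes with base change A → k(s) to any residue field. -/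
open TensorProduct

/-- The `j+1`-st cohomology submodule data: the boundaries `B^{j+1} = im (d j)` viewed as a
submodule of the cycles `Z^{j+1} = ker (d (j+1))`. -/
noncomputable def boundariesInCycles {A : Type*} [CommRing A] {C : ℤ → Type*}
    [∀ j, AddCommGroup (C j)] [∀ j, Module A (C j)]
    (d : ∀ j : ℤ, C j →ₗ[A] C (j + 1)) (j : ℤ) :
    Submodule A ↥(LinearMap.ker (d (j + 1))) :=
  (LinearMap.range (d j)).comap (LinearMap.ker (d (j + 1))).subtype

section FlatCokernel

variable {A N P Q : Type*} [CommRing A] [AddCommGroup N] [Module A N] [AddCommGroup P]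
  [Module A P] [AddCommGroup Q] [Module A Q] [Module.Flat A Q] {f : N →ₗ[A] P} {g : P →ₗ[A] Q}

/-- The diagram chase behind `LinearMap.rTensor_injective_of_flat_of_exact`, for a chosen flat
presentation `K → F → M` of the module being tensored with. -/
theorem LinearMap.rTensor_injective_of_flat_presentation {K F M : Type*} [AddCommGroup K]
    [Module A K] [AddCommGroup F] [Module A F] [AddCommGroup M] [Module A M] [Module.Flat A F]
    {ι : K →ₗ[A] F} {π : F →ₗ[A] M} (hι : Function.Injective ι) (hιπ : Function.Exact ι π)
    (hπ : Function.Surjective π) (hf : Function.Injective f) (hfg : Function.Exact f g)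
    (hg : Function.Surjective g) : Function.Injective (f.rTensor M) := by
  rw [injective_iff_map_eq_zero]
  intro x hx
  obtain ⟨y, rfl⟩ := LinearMap.lTensor_surjective N hπ x
  have hy : π.lTensor P (f.rTensor _ y) = 0 := by
    rw [← hx, ← LinearMap.comp_apply, ← LinearMap.comp_apply, LinearMap.lTensor_comp_rTensor,
      LinearMap.rTensor_comp_lTensor]
  obtain ⟨w, hw⟩ := (lTensor_exact P hιπ hπ _).1 hy
  have hgw : g.rTensor _ w = 0 := by
    apply Module.Flat.lTensor_preserves_injective_linearMap (M := Q) ι hι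
    rw [map_zero, ← LinearMap.comp_apply, LinearMap.lTensor_comp_rTensor,
      ← LinearMap.rTensor_comp_lTensor, LinearMap.comp_apply, hw, ← LinearMap.comp_apply,
      ← LinearMap.rTensor_comp, hfg.linearMap_comp_eq_zero, LinearMap.rTensor_zero,
      LinearMap.zero_apply]
  obtain ⟨v, rfl⟩ := (rTensor_exact _ hfg hg _).1 hgw
  have hyv : y = ι.lTensor N v := by
    apply Module.Flat.rTensor_preserves_injective_linearMap (M := F) f hf
    rw [← hw, ← LinearMap.comp_apply, ← LinearMap.comp_apply, LinearMap.lTensor_comp_rTensor,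
      LinearMap.rTensor_comp_lTensor]
  exact (lTensor_exact N hιπ hπ _).2 ⟨v, hyv.symm⟩

/-- Tensoring a short exact sequence whose cokernel term is flat preserves injectivity. -/
theorem LinearMap.rTensor_injective_of_flat_of_exact (hf : Function.Injective f)
    (hfg : Function.Exact f g) (hg : Function.Surjective g)
    (M : Type*) [AddCommGroup M] [Module A M] : Function.Injective (f.rTensor M) :=
  LinearMap.rTensor_injective_of_flat_presentation
    (LinearMap.ker (Finsupp.linearCombination A (_root_.id : M → M))).injective_subtype
    (LinearMap.exact_subtype_ker_map _) (Finsupp.linearCombination_id_surjective A M) hf hfg hg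

end FlatCokernel

section Cycles

variable {A X Y : Type*} [CommRing A] [AddCommGroup X] [Module A X] [AddCommGroup Y] [Module A Y]
  (f : X →ₗ[A] Y) (M : Type*) [AddCommGroup M] [Module A M]

theorem LinearMap.exact_ker_subtype_rangeRestrict :
    Function.Exact (LinearMap.ker f).subtype f.rangeRestrict := by
  rw [LinearMap.exact_iff, Submodule.range_subtype, LinearMap.ker_rangeRestrict]

theorem LinearMap.rTensor_ker_subtype_injective [Module.Flat A (LinearMap.range f)] :
    Function.Injective ((LinearMap.ker f).subtype.rTensor M) :=
  LinearMap.rTensor_injective_of_flat_of_exact (g := f.rangeRestrict)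
    (LinearMap.ker f).injective_subtype
    f.exact_ker_subtype_rangeRestrict f.surjective_rangeRestrict M

/-- The natural map from the base change of the kernel to the kernel of the base change. -/
noncomputable def LinearMap.kerRTensor :
    LinearMap.ker f ⊗[A] M →ₗ[A] LinearMap.ker (f.rTensor M) :=
  ((LinearMap.ker f).subtype.rTensor M).codRestrict _ fun x => by
    rw [LinearMap.mem_ker, ← LinearMap.comp_apply, ← LinearMap.rTensor_comp,
      (LinearMap.exact_subtype_ker_map f).linearMap_comp_eq_zero, LinearMap.rTensor_zero,
      LinearMap.zero_apply]

theorem LinearMap.kerRTensor_bijective [Module.Flat A (LinearMap.range f)]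
    (hB : Function.Injective ((LinearMap.range f).subtype.rTensor M)) :
    Function.Bijective (f.kerRTensor M) := by
  refine ⟨fun x y h => f.rTensor_ker_subtype_injective M (congrArg Subtype.val h), ?_⟩
  rintro ⟨y, hy⟩
  have hy' : f.rangeRestrict.rTensor M y = 0 := by
    apply hB
    rw [map_zero, ← LinearMap.comp_apply, ← LinearMap.rTensor_comp]
    exact hy
  obtain ⟨x, hx⟩ := (rTensor_exact M f.exact_ker_subtype_rangeRestrict f.surjective_rangeRestrict y).1 hy'
  exact ⟨x, Subtype.ext hx⟩

end Cycles

section Complex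

variable {A : Type*} [CommRing A] {C : ℤ → Type*} [∀ j, AddCommGroup (C j)]
  [∀ j, Module A (C j)] {d : ∀ j : ℤ, C j →ₗ[A] C (j + 1)}

theorem rTensor_range_subtype_injective
    (hdd : ∀ j : ℤ, (d (j + 1)).comp (d j) = 0) (M : Type*) [AddCommGroup M] [Module A M] (j : ℤ)
    [Module.Flat A (LinearMap.range (d (j + 1)))]
    [Module.Flat A (LinearMap.ker (d (j + 1)) ⧸ boundariesInCycles d j)] :
    Function.Injective ((LinearMap.range (d j)).subtype.rTensor M) := by
  have hle : LinearMap.range (d j) ≤ LinearMap.ker (d (j + 1)) :=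
    LinearMap.range_le_ker_iff.2 (hdd j)
  have hexact : Function.Exact (Submodule.inclusion hle) (boundariesInCycles d j).mkQ := by
    rw [LinearMap.exact_iff, Submodule.ker_mkQ, Submodule.range_inclusion]
    rfl
  have hinj := LinearMap.rTensor_injective_of_flat_of_exact (Submodule.inclusion_injective hle)
    hexact (boundariesInCycles d j).mkQ_surjective M
  have hcomp := ((d (j + 1)).rTensor_ker_subtype_injective M).comp hinj
  rwa [← LinearMap.coe_comp, ← LinearMap.rTensor_comp, Submodule.subtype_comp_inclusion] at hcomp

theorem map_kerRTensor_boundariesInCycles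
    (hdd : ∀ j : ℤ, (d (j + 1)).comp (d j) = 0) (M : Type*) [AddCommGroup M] [Module A M] (j : ℤ) :
    (LinearMap.range (TensorProduct.map (boundariesInCycles d j).subtype
      (LinearMap.id : M →ₗ[A] M))).map ((d (j + 1)).kerRTensor M) =
      boundariesInCycles (fun i => (d i).rTensor M) j := by
  have hmem (x : C j) : d j x ∈ LinearMap.ker (d (j + 1)) := LinearMap.congr_fun (hdd j) x
  let δ : C j →ₗ[A] boundariesInCycles d j :=
    ((d j).codRestrict _ hmem).codRestrict _ fun x => ⟨x, rfl⟩
  have hδ : Function.Surjective δ := by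
    rintro ⟨_, x, hx⟩
    exact ⟨x, Subtype.ext (Subtype.ext hx)⟩
  have hd (t : C j ⊗[A] M) : ((d (j + 1)).kerRTensor M
      ((boundariesInCycles d j).subtype.rTensor M (δ.rTensor M t))).1 = (d j).rTensor M t := by
    change ((LinearMap.ker (d (j + 1))).subtype.rTensor M) _ = _
    rw [← LinearMap.comp_apply, ← LinearMap.comp_apply, ← LinearMap.rTensor_comp,
      ← LinearMap.rTensor_comp]
    rfl
  ext y
  constructor
  · rintro ⟨_, ⟨u, rfl⟩, rfl⟩
    obtain ⟨t, rfl⟩ := LinearMap.rTensor_surjective M hδ u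
    exact ⟨t, (hd t).symm⟩
  · rintro ⟨t, ht⟩
    exact ⟨_, ⟨δ.rTensor M t, rfl⟩, Subtype.ext ((hd t).trans ht)⟩

end Complex

/-- **Base change for cohomology of a complex with flat boundaries and cohomologies.**
Let `A` be a commutative ring and `C•` a bounded cochain complex of `A`-modules (given by
modules `C j` for `j : ℤ` and differentials `d j : C j → C (j+1)` with `d ∘ d = 0`) such that
for every index the boundary module `B^{j+1} = im (d j)` and the cohomology module
`H^{j+1} = ker (d (j+1)) / im (d j)` are flat `A`-modules.  Then for every `A`-module `M` and
every index, the natural map `H^{j+1}(C•) ⊗ M → H^{j+1}(C• ⊗ M)`, sending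
`(class of z) ⊗ m` to `class of (z ⊗ m)`, is an isomorphism.  (Since the indexing is over
`ℤ`, the indices of the form `j+1` exhaust all indices.) -/
theorem stmt9 {A : Type*} [CommRing A] (C : ℤ → Type*)
    [∀ j, AddCommGroup (C j)] [∀ j, Module A (C j)]
    (d : ∀ j : ℤ, C j →ₗ[A] C (j + 1))
    (hdd : ∀ j : ℤ, (d (j + 1)).comp (d j) = 0)
    (hbdd : ∃ a b : ℤ, ∀ j : ℤ, (j < a ∨ b < j) → Subsingleton (C j))
    (hBflat : ∀ j : ℤ, Module.Flat A ↥(LinearMap.range (d j)))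
    (hHflat : ∀ j : ℤ, Module.Flat A
      (↥(LinearMap.ker (d (j + 1))) ⧸ boundariesInCycles d j))
    (M : Type*) [AddCommGroup M] [Module A M] (j : ℤ) :
    ∃ e : ((↥(LinearMap.ker (d (j + 1))) ⧸ boundariesInCycles d j) ⊗[A] M) ≃ₗ[A]
        (↥(LinearMap.ker (LinearMap.rTensor M (d (j + 1)))) ⧸
          boundariesInCycles (fun i => LinearMap.rTensor M (d i)) j),
      ∀ (z : ↥(LinearMap.ker (d (j + 1)))) (m : M),
        e ((Submodule.Quotient.mk z) ⊗ₜ[A] m)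
          = Submodule.Quotient.mk
              ⟨z.1 ⊗ₜ[A] m, by
                have hz : d (j + 1) z.1 = 0 := z.2
                simp [LinearMap.mem_ker, LinearMap.rTensor_tmul, hz]⟩ := by
  have := hBflat (j + 1)
  have := hBflat (j + 1 + 1)
  have := hHflat (j + 1)
  let φ := LinearEquiv.ofBijective _ ((d (j + 1)).kerRTensor_bijective M
    (rTensor_range_subtype_injective hdd M (j + 1)))
  exact ⟨TensorProduct.quotientTensorEquiv M (boundariesInCycles d j) ≪≫ₗ
    Submodule.Quotient.equiv _ _ φ (map_kerRTensor_boundariesInCycles hdd M j), fun _ _ => rfl⟩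
end
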